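/- arXiv:2406.17422 — 5 statements merged into one kernel-verified Lean document; each statement's English description precedes it below -/
import Mathlib

section
/- Let V be a finite set and D ⊆ V×V a relation whose directed graph is acyclic, let K be a field, and let H ∈ K^{V×V} be a matrix with H_{v,w} = 0 whenever (v,w) ∉ D. Then I − H is invertible, and for all subsets X, Y ⊆ V with |X| = |Y| = r and fixed enumerations of X and Y, det([(I−H)⁻¹]_{X,Y}) = Σ_Π sgn(Π) · ∏_{(u,u') edge of Π} H_{u,u'}, where the (finite) sum ranges over all systems Π of non-intersecting directed paths from X to Y. In particular, this determinant is zero whenever every system of directed paths from X to Y has an intersection. -/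
open Matrix
open scoped BigOperators

/-- A directed path in the graph with edge relation `E`: a nonempty list of vertices in
which consecutive vertices are joined by edges. A one-element list is the empty path at
that vertex. -/
structure DiPath {V : Type*} (E : V → V → Prop) where
  verts : List V
  ne : verts ≠ []
  chain : verts.Chain' E

namespace DiPath

variable {V : Type*} {E : V → V → Prop}

/-- The starting point of a directed path. -/
def first (p : DiPath E) : V := p.verts.head p.ne

/-- The endpoint of a directed path. -/
def last (p : DiPath E) : V := p.verts.getLast p.ne

/-- The list of edges traversed by a directed path. -/
def edges (p : DiPath E) : List (V × V) := p.verts.zip p.verts.tail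

/-- The weight of a directed path: the product of the matrix entries `H_{u,u'}` over all
its edges (an empty path has weight `1`). -/
def weight {K : Type*} [CommRing K] (H : Matrix V V K) (p : DiPath E) : K :=
  (p.edges.map fun e => H e.1 e.2).prod

end DiPath

/-- A system of non-intersecting directed paths from the enumerated set
`X = {x 0, …, x (r-1)}` to `Y = {y 0, …, y (r-1)}`: paths with pairwise disjoint vertex
sets, the `i`-th path going from `x i` to `y (perm i)`. -/
structure PathSystem {V : Type*} (E : V → V → Prop) (r : ℕ) (x y : Fin r → V) where
  path : Fin r → DiPath E
  perm : Equiv.Perm (Fin r)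
  first_eq : ∀ i, (path i).first = x i
  last_eq : ∀ i, (path i).last = y (perm i)
  disjoint : ∀ i j, i ≠ j → ∀ v ∈ (path i).verts, v ∉ (path j).verts

namespace LGVAux

variable {V K : Type*}

def wt [CommRing K] (H : Matrix V V K) (l : List V) : K :=
  ((l.zip l.tail).map fun e => H e.1 e.2).prod

def RS (D : V → V → Prop) (S : Finset V) (u v : V) : Prop := u ∈ S ∧ D u v

structure Good (D : V → V → Prop) (S : Finset V) {r : ℕ} (x y : Fin r → V)
    (q : (Fin r → List V) × Equiv.Perm (Fin r)) : Prop where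
  hd : ∀ i, (q.1 i).head? = some (x i)
  lst : ∀ i, (q.1 i).getLast? = some (y (q.2 i))
  ch : ∀ i, (q.1 i).IsChain (RS D S)
  dj : ∀ i j, i ≠ j → ∀ v ∈ q.1 i, v ∉ q.1 j

def term [CommRing K] (H : Matrix V V K) {r : ℕ}
    (q : (Fin r → List V) × Equiv.Perm (Fin r)) : K :=
  ((Equiv.Perm.sign q.2 : ℤ) : K) * ∏ i, wt H (q.1 i)

theorem chain_aux [DecidableEq V] {D : V → V → Prop} {S : Finset V} {s : V}
    (hs : ∀ u ∈ S, ¬ D u s) (l : List V) (h : l.IsChain (RS D S)) (hh : l.head? ≠ some s) :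
    s ∉ l ∧ l.IsChain (RS D (S.erase s)) := by
  induction l with
  | nil => simp
  | cons a t ih =>
    have ha : a ≠ s := by simpa using hh
    cases t with
    | nil => simp [Ne.symm ha]
    | cons b t =>
      rw [List.isChain_cons_cons] at h
      have hb : b ≠ s := by
        rintro rfl
        exact hs a h.1.1 h.1.2
      have := ih h.2 (by simpa using hb)
      refine ⟨?_, ?_⟩
      · rw [List.mem_cons, not_or]
        exact ⟨Ne.symm ha, this.1⟩
      · rw [List.isChain_cons_cons]
        exact ⟨⟨Finset.mem_erase.2 ⟨ha, h.1.1⟩, h.1.2⟩, this.2⟩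

theorem chain_mono {D : V → V → Prop} {S T : Finset V} (hST : S ⊆ T) {l : List V}
    (h : l.IsChain (RS D S)) : l.IsChain (RS D T) :=
  h.imp fun _ _ hab => ⟨hST hab.1, hab.2⟩

theorem Good.mono {D : V → V → Prop} {S T : Finset V} (hST : S ⊆ T) {r : ℕ} {x y : Fin r → V}
    {q} (h : Good D S x y q) : Good D T x y q :=
  ⟨h.hd, h.lst, fun i => chain_mono hST (h.ch i), h.dj⟩

theorem Good.inj {D : V → V → Prop} {S : Finset V} {r : ℕ} {x y : Fin r → V}
    {q} (h : Good D S x y q) : Function.Injective x := by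
  intro i j hij
  by_contra hne
  have h1 := List.mem_of_mem_head? (h.hd i)
  have h2 := List.mem_of_mem_head? (h.hd j)
  rw [← hij] at h2
  exact h.dj i j hne _ h1 h2

def consAt {r : ℕ} (i : Fin r) (s : V) (q : (Fin r → List V) × Equiv.Perm (Fin r)) :
    (Fin r → List V) × Equiv.Perm (Fin r) :=
  (Function.update q.1 i (s :: q.1 i), q.2)

theorem consAt_inj {r : ℕ} (i : Fin r) (s : V) : Function.Injective (consAt (V := V) i s) := by
  rintro ⟨p, σ⟩ ⟨p', σ'⟩ h
  simp only [consAt, Prod.mk.injEq] at h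
  obtain ⟨h1, rfl⟩ := h
  congr 1
  funext k
  have := congrFun h1 k
  by_cases hk : k = i
  · subst hk; simpa using this
  · simpa [hk] using this

theorem good_not_start [DecidableEq V] {D : V → V → Prop} {S : Finset V} {s : V}
    (hs : ∀ u ∈ S, ¬ D u s) {r : ℕ} {x y : Fin r → V} (hx : ∀ i, x i ≠ s) :
    {q | Good D S x y q} = {q | Good D (S.erase s) x y q} := by
  ext q
  refine ⟨fun h => ⟨h.hd, h.lst, fun i => (chain_aux hs _ (h.ch i) ?_).2, h.dj⟩,
    fun h => h.mono (Finset.erase_subset _ _)⟩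
  rw [h.hd]; simpa using hx i

theorem good_start [DecidableEq V] {D : V → V → Prop} {S : Finset V} {s : V} (hsS : s ∈ S)
    (hs : ∀ u ∈ S, ¬ D u s) {r : ℕ} {x y : Fin r → V} (hx : Function.Injective x) (i : Fin r)
    (hi : x i = s) :
    {q | Good D S x y q} = {q | Good D (S.erase s) x y q} ∪
      ⋃ w ∈ {w | D s w}, consAt i s '' {q | Good D (S.erase s) (Function.update x i w) y q} := by
  have hxs : ∀ j, j ≠ i → x j ≠ s := fun j hj h => hj (hx (h.trans hi.symm))
  ext ⟨p, σ⟩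
  simp only [Set.mem_union, Set.mem_iUnion, Set.mem_image, Set.mem_ofPred_eq, exists_prop]
  constructor
  · intro h
    have hch : ∀ j, j ≠ i → s ∉ p j ∧ (p j).IsChain (RS D (S.erase s)) := fun j hj =>
      chain_aux hs _ (h.ch j) (by rw [h.hd]; simpa using hxs j hj)
    have h1 := h.hd i
    have h2 := h.ch i
    have h3 := h.lst i
    simp only at h1 h2 h3
    rcases hp : p i with _ | ⟨a, t⟩
    · simp [hp] at h1
    · have ha : a = s := by rw [hp] at h1; simpa [hi] using h1
      subst ha
      rcases t with _ | ⟨w, t⟩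
      · left
        refine ⟨h.hd, h.lst, fun j => ?_, h.dj⟩
        by_cases hj : j = i
        · subst hj; simp [hp]
        · exact (hch j hj).2
      · right
        rw [hp, List.isChain_cons_cons] at h2
        have hw : w ≠ a := by rintro rfl; exact hs _ hsS h2.1.2
        have hsub : ∀ j, ∀ v ∈ Function.update p i (w :: t) j, v ∈ p j := by
          intro j v hv
          by_cases hj : j = i
          · subst hj
            rw [hp]
            rw [Function.update_self] at hv
            exact List.mem_cons_of_mem _ hv
          · rwa [Function.update_of_ne hj] at hv
        refine ⟨w, h2.1.2, (Function.update p i (w :: t), σ), ⟨?_, ?_, ?_, ?_⟩, ?_⟩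
        · intro j
          by_cases hj : j = i
          · subst hj; simp
          · simpa [hj] using h.hd j
        · intro j
          by_cases hj : j = i
          · subst hj
            rw [hp, List.getLast?_cons_cons] at h3
            simpa using h3
          · simpa [hj] using h.lst j
        · intro j
          by_cases hj : j = i
          · subst hj
            simpa using (chain_aux hs _ h2.2 (by simpa using hw)).2
          · simpa [hj] using (hch j hj).2
        · intro j k hjk v hv hv'
          exact h.dj j k hjk v (hsub j v hv) (hsub k v hv')
        · simp only [consAt, Function.update_self, Function.update_idem, Prod.mk.injEq, and_true]
          rw [← hp, Function.update_eq_self]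
  · rintro (h | ⟨w, hw, ⟨p', σ'⟩, h, he⟩)
    · exact h.mono (Finset.erase_subset _ _)
    · simp only [consAt, Prod.mk.injEq] at he
      obtain ⟨rfl, rfl⟩ := he
      have hh := h.hd i
      simp only [Function.update_self] at hh
      have hns : ∀ j, j ≠ i → s ∉ p' j := by
        intro j hj
        refine (chain_aux hs _ (chain_mono (Finset.erase_subset _ _) (h.ch j)) ?_).1
        rw [h.hd, Function.update_of_ne hj]
        simpa using hxs j hj
      refine ⟨?_, ?_, ?_, ?_⟩
      · intro j
        by_cases hj : j = i
        · subst hj; simp [hi]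
        · simpa [hj] using h.hd j
      · intro j
        by_cases hj : j = i
        · subst hj
          have := h.lst j
          simp only at this
          simp [List.getLast?_cons, this]
        · simpa [hj] using h.lst j
      · intro j
        have h2 := chain_mono (Finset.erase_subset s S) (h.ch j)
        simp only at h2
        by_cases hj : j = i
        · subst hj
          simp only [Function.update_self]
          rcases hp : p' j with _ | ⟨a, t⟩
          · simp
          · rw [hp] at h2 hh
            have : a = w := by simpa using hh
            subst this
            rw [List.isChain_cons_cons]
            exact ⟨⟨hsS, hw⟩, h2⟩
        · simpa [hj] using h2
      · intro j k hjk v hv hv'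
        have hdj := h.dj j k hjk v
        simp only at hdj hv hv'
        by_cases hj : j = i
        · subst hj
          rw [Function.update_of_ne (Ne.symm hjk)] at hv'
          rw [Function.update_self, List.mem_cons] at hv
          rcases hv with rfl | hv
          · exact hns k (Ne.symm hjk) hv'
          · exact hdj hv hv'
        · rw [Function.update_of_ne hj] at hv
          by_cases hk : k = i
          · subst hk
            rw [Function.update_self, List.mem_cons] at hv'
            rcases hv' with rfl | hv'
            · exact hns j hj hv
            · exact hdj hv hv'
          · rw [Function.update_of_ne hk] at hv'
            exact hdj hv hv'

theorem term_consAt [CommRing K] (H : Matrix V V K) {D : V → V → Prop} {S : Finset V} {s w : V}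
    {r : ℕ} {x y : Fin r → V} (i : Fin r) {q} (h : Good D S (Function.update x i w) y q) :
    term H (consAt i s q) = H s w * term H q := by
  obtain ⟨p, σ⟩ := q
  have hh := h.hd i
  simp only [Function.update_self] at hh
  have h1 : wt H (s :: p i) = H s w * wt H (p i) := by
    rcases hp : p i with _ | ⟨a, t⟩
    · simp [hp] at hh
    · rw [hp] at hh
      have : a = w := by simpa using hh
      subst this
      simp [wt]
  have h2 : ∏ k, wt H (Function.update p i (s :: p i) k) = H s w * ∏ k, wt H (p k) := by
    rw [← Finset.mul_prod_erase _ _ (Finset.mem_univ i),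
      ← Finset.mul_prod_erase Finset.univ (fun k => wt H (p k)) (Finset.mem_univ i),
      Function.update_self, h1, mul_assoc]
    congr 2
    refine Finset.prod_congr rfl fun k hk => ?_
    rw [Function.update_of_ne (Finset.ne_of_mem_erase hk)]
  simp only [term, consAt, h2]
  ring

theorem good_empty_iff {D : V → V → Prop} {r : ℕ} {x y : Fin r → V} (hx : Function.Injective x) :
    {q | Good D ∅ x y q} =
      (fun σ : Equiv.Perm (Fin r) => ((fun i => [x i]), σ)) '' {σ | ∀ i, x i = y (σ i)} := by
  ext ⟨p, σ⟩
  simp only [Set.mem_image, Set.mem_ofPred_eq, Prod.mk.injEq]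
  constructor
  · intro h
    have hp : p = fun i => [x i] := by
      funext i
      have h1 := h.hd i
      have h2 := h.ch i
      simp only at h1 h2
      rcases hp : p i with _ | ⟨a, _ | ⟨b, t⟩⟩
      · simp [hp] at h1
      · simpa [hp] using h1
      · rw [hp, List.isChain_cons_cons] at h2
        simpa using h2.1.1
    subst hp
    refine ⟨σ, fun i => ?_, rfl, rfl⟩
    simpa using h.lst i
  · rintro ⟨τ, h, rfl, rfl⟩
    refine ⟨fun i => by simp, fun i => by simp [h], fun i => by simp, ?_⟩
    intro i j hij v hv hv'
    simp only [List.mem_singleton] at hv hv'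
    exact hij (hx (hv.symm.trans hv'))

theorem base [CommRing K] [DecidableEq V] (D : V → V → Prop) (H : Matrix V V K) {r : ℕ}
    (x y : Fin r → V) (hx : Function.Injective x) :
    ((1 : Matrix V V K).submatrix x y).det = ∑ᶠ q ∈ {q | Good D ∅ x y q}, term H q := by
  classical
  rw [good_empty_iff hx, finsum_mem_image (fun a _ b _ h => (Prod.mk.inj h).2),
    ← Matrix.det_transpose, Matrix.det_apply']
  rw [finsum_mem_eq_toFinset_sum, Set.toFinset_ofPred, Finset.sum_filter]
  refine Finset.sum_congr rfl fun σ _ => ?_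
  have : ∀ v : V, wt H [v] = 1 := fun v => by simp [wt]
  simp only [term, this, Matrix.transpose_apply, Matrix.submatrix_apply, Matrix.one_apply]
  by_cases h : ∀ i, x i = y (σ i)
  · simp [h]
  · rw [if_neg h]
    push Not at h
    obtain ⟨i, hi⟩ := h
    rw [Finset.prod_eq_zero (Finset.mem_univ i) (if_neg hi), mul_zero]

theorem good_erase_singleton [DecidableEq V] {D : V → V → Prop} {S : Finset V} {s : V}
    {r : ℕ} {x y : Fin r → V} (i : Fin r) (hi : x i = s) {q}
    (h : Good D (S.erase s) x y q) : q.1 i = [s] := by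
  have h1 := h.hd i
  have h2 := h.ch i
  rcases hp : q.1 i with _ | ⟨a, _ | ⟨b, t⟩⟩
  · simp [hp] at h1
  · simpa [hp, hi] using h1
  · rw [hp, List.isChain_cons_cons] at h2
    rw [hp] at h1
    have : a = s := by simpa [hi] using h1
    exact absurd this (Finset.mem_erase.1 h2.1.1).1

theorem main [Fintype V] [DecidableEq V] [CommRing K]
    (D : V → V → Prop) (hacyc : ∀ v, ¬ Relation.TransGen D v v)
    (H : Matrix V V K) (hH : ∀ v w, ¬ D v w → H v w = 0) (r : ℕ) (y : Fin r → V) :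
    ∀ (n : ℕ) (S : Finset V), S.card = n → ∃ G : Matrix V V K,
      G = 1 + (Matrix.of fun u v => if u ∈ S then H u v else 0) * G ∧
      ∀ x : Fin r → V, {q | Good D S x y q}.Finite ∧
        (G.submatrix x y).det = ∑ᶠ q ∈ {q | Good D S x y q}, term H q := by
  classical
  have noninj : ∀ (S : Finset V) (G : Matrix V V K) (x : Fin r → V), ¬ Function.Injective x →
      {q | Good D S x y q}.Finite ∧
        (G.submatrix x y).det = ∑ᶠ q ∈ {q | Good D S x y q}, term H q := by
    intro S G x hx
    have : {q | Good D S x y q} = ∅ := by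
      ext q
      simp only [Set.mem_ofPred_eq, Set.mem_empty_iff_false, iff_false]
      exact fun h => hx h.inj
    rw [this]
    refine ⟨Set.finite_empty, ?_⟩
    rw [finsum_mem_empty]
    simp only [Function.Injective, not_forall] at hx
    obtain ⟨i, j, hij, hne⟩ := hx
    exact Matrix.det_zero_of_row_eq hne (by funext k; simp [hij])
  intro n
  induction n with
  | zero =>
    intro S hS
    rw [Finset.card_eq_zero] at hS
    subst hS
    refine ⟨1, ?_, fun x => ?_⟩
    · have : (Matrix.of fun u v => if u ∈ (∅ : Finset V) then H u v else 0) = 0 := by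
        ext u v; simp
      rw [this]; simp
    · by_cases hx : Function.Injective x
      · refine ⟨?_, base D H x y hx⟩
        rw [good_empty_iff hx]
        exact (Set.toFinite _).image _
      · exact noninj _ _ _ hx
  | succ n ih =>
    intro S hS
    have hwf : WellFounded (Relation.TransGen D) := by
      have : Std.Irrefl (Relation.TransGen D) := ⟨hacyc⟩
      exact Finite.wellFounded_of_trans_of_irrefl _
    have hne : S.Nonempty := Finset.card_pos.1 (by omega)
    obtain ⟨s, hsS, hmin⟩ := hwf.has_min (S : Set V) hne
    have hs : ∀ u ∈ S, ¬ D u s := fun u hu h => hmin u hu (Relation.TransGen.single h)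
    have hsS : s ∈ S := hsS
    obtain ⟨G', hG', hsum⟩ := ih (S.erase s) (by rw [Finset.card_erase_of_mem hsS]; omega)
    have hG'e : ∀ u v, G' u v = (1 : Matrix V V K) u v +
        ∑ w, (if u ∈ S.erase s then H u w else 0) * G' w v := by
      intro u v
      conv_lhs => rw [hG']
      simp [Matrix.mul_apply]
    let G : Matrix V V K := Matrix.of fun u v =>
      if u = s then G' s v + ∑ w, H s w * G' w v else G' u v
    have hGs : ∀ v, G s v = G' s v + ∑ w, H s w * G' w v := fun v => by simp [G]
    have hGu : ∀ u, u ≠ s → ∀ v, G u v = G' u v := fun u hu v => by simp [G, hu]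
    refine ⟨G, ?_, ?_⟩
    · ext u v
      rw [Matrix.add_apply, Matrix.mul_apply]
      simp only [Matrix.of_apply]
      have key : ∀ w, (if u ∈ S then H u w else 0) * G w v =
          (if u ∈ S then H u w else 0) * G' w v := by
        intro w
        by_cases hw : w = s
        · subst hw
          by_cases hu : u ∈ S
          · simp [hH _ _ (hs u hu)]
          · simp [hu]
        · rw [hGu w hw]
      simp only [key]
      by_cases hu : u = s
      · subst hu
        rw [hGs, hG'e u v]
        simp [hsS]
      · rw [hGu u hu, hG'e u v]
        simp [hu]
    · intro x
      by_cases hx : Function.Injective x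
      swap
      · exact noninj _ _ _ hx
      by_cases hxs : ∀ i, x i ≠ s
      · rw [good_not_start hs hxs]
        refine ⟨(hsum x).1, ?_⟩
        rw [← (hsum x).2]
        congr 1
        ext i j
        simp [hGu _ (hxs i)]
      · push Not at hxs
        obtain ⟨i, hi⟩ := hxs
        have hxs : ∀ j, j ≠ i → x j ≠ s := fun j hj h => hj (hx (h.trans hi.symm))
        have hfin : ∀ w, (consAt i s ''
            {q | Good D (S.erase s) (Function.update x i w) y q}).Finite := fun w =>
          (hsum _).1.image _
        have hfinU : (⋃ w ∈ {w | D s w}, consAt i s ''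
            {q | Good D (S.erase s) (Function.update x i w) y q}).Finite :=
          (Set.toFinite _).biUnion fun w _ => hfin w
        rw [good_start hsS hs hx i hi]
        refine ⟨(hsum x).1.union hfinU, ?_⟩
        rw [finsum_mem_union ?_ (hsum x).1 hfinU, finsum_mem_biUnion ?_ (Set.toFinite _)
          (fun w _ => hfin w)]
        · have e1 : ∀ w, ∑ᶠ q ∈ consAt i s ''
              {q | Good D (S.erase s) (Function.update x i w) y q}, term H q =
              H s w * (G'.submatrix (Function.update x i w) y).det := by
            intro w
            rw [finsum_mem_image (consAt_inj i s).injOn, (hsum _).2, mul_finsum_mem' _ _ (hsum _).1]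
            exact finsum_mem_congr rfl fun q hq => term_consAt H i hq
          simp only [e1]
          rw [← (hsum x).2, finsum_mem_eq_toFinset_sum, Set.toFinset_ofPred, Finset.sum_filter]
          have e2 : ∀ w, (if D s w then H s w * (G'.submatrix (Function.update x i w) y).det
              else 0) = H s w * (G'.submatrix (Function.update x i w) y).det := by
            intro w
            split_ifs with h
            · rfl
            · rw [hH _ _ h, zero_mul]
          simp only [e2]
          have e3 : G.submatrix x y = (G'.submatrix x y).updateRow i
              ((fun j => G' s (y j)) + ∑ w, H s w • fun j => G' w (y j)) := by
            ext j k
            by_cases hj : j = i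
            · subst hj
              simp [hi, hGs]
            · simp [hj, hGu _ (hxs j hj)]
          have e4 : ∀ w, G'.submatrix (Function.update x i w) y =
              (G'.submatrix x y).updateRow i (fun j => G' w (y j)) := by
            intro w
            ext j k
            by_cases hj : j = i
            · subst hj
              simp
            · simp [hj]
          have e5 : G'.submatrix x y = (G'.submatrix x y).updateRow i (fun j => G' s (y j)) := by
            rw [← e4, ← hi, Function.update_eq_self]
          rw [e3, Matrix.det_updateRow_add, ← e5]
          congr 1
          simp only [e4]
          have := (Matrix.detRowAlternating (n := Fin r) (R := K)).toMultilinearMap.map_update_sum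
            Finset.univ i (fun w => H s w • fun j => G' w (y j)) (G'.submatrix x y)
          refine Eq.trans this (Finset.sum_congr rfl fun w _ => ?_)
          exact Matrix.det_updateRow_smul _ _ _ _
        · intro w _ w' _ hww
          refine Set.disjoint_left.2 ?_
          rintro q ⟨a, ha, rfl⟩ ⟨b, hb, hab⟩
          rw [consAt_inj i s hab] at hb
          have h1 := ha.hd i
          rw [hb.hd i] at h1
          exact hww (by simpa using h1.symm)
        · refine Set.disjoint_left.2 ?_
          intro q hq hq'
          simp only [Set.mem_iUnion] at hq'
          obtain ⟨w, _, a, ha, rfl⟩ := hq'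
          have h1 := good_erase_singleton i hi hq
          have h2 := ha.hd i
          simp only [consAt, Function.update_self, List.cons.injEq, true_and] at h1
          simp [h1] at h2

def toGood [Fintype V] {D : V → V → Prop} {r : ℕ} {x y : Fin r → V} (P : PathSystem D r x y) :
    {q | Good D Finset.univ x y q} :=
  ⟨(fun i => (P.path i).verts, P.perm),
    ⟨fun i => by
        rw [← P.first_eq i]; exact List.head?_eq_some_head _,
     fun i => by
        rw [← P.last_eq i]; exact List.getLast?_eq_some_getLast _,
     fun i => (P.path i).chain.imp fun _ _ h => ⟨Finset.mem_univ _, h⟩,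
     P.disjoint⟩⟩

theorem toGood_bij [Fintype V] {D : V → V → Prop} {r : ℕ} {x y : Fin r → V} :
    Function.Bijective (toGood (D := D) (x := x) (y := y)) := by
  constructor
  · rintro ⟨p, σ, _, _, _⟩ ⟨p', σ', _, _, _⟩ h
    simp only [toGood, Subtype.mk.injEq, Prod.mk.injEq] at h
    obtain ⟨h1, rfl⟩ := h
    have : p = p' := by
      funext i
      have := congrFun h1 i
      cases hp : p i
      cases hp' : p' i
      simp only [hp, hp'] at this
      subst this
      rfl
    subst this
    rfl
  · rintro ⟨⟨p, σ⟩, h⟩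
    have hne : ∀ i, p i ≠ [] := by
      intro i hi
      have := h.hd i
      simp [hi] at this
    refine ⟨⟨fun i => ⟨p i, hne i, (h.ch i).imp fun _ _ h => h.2⟩, σ, fun i => ?_, fun i => ?_,
      h.dj⟩, rfl⟩
    · have := h.hd i
      simp only [List.head?_eq_some_head (hne i), Option.some.injEq] at this
      exact this
    · have := h.lst i
      simp only [List.getLast?_eq_some_getLast (hne i), Option.some.injEq] at this
      exact this

end LGVAux

/-- let `V` be finite, `D` an acyclic edge relation on `V`, `K` a field and
`H ∈ K^{V×V}` supported on `D`. Then `I − H` is invertible and, for equal-sized enumerated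
subsets `X, Y ⊆ V`, `det([(I−H)⁻¹]_{X,Y})` equals the (finite) sum over all systems `Π` of
non-intersecting directed paths from `X` to `Y` of `sgn(Π)` times the product of the entries
`H_{u,u'}` over the edges of `Π`. In particular the determinant vanishes whenever every
system of directed paths from `X` to `Y` has an intersection. -/
theorem det_inv_one_sub_submatrix_eq_sum_pathSystems
    {V K : Type*} [Fintype V] [DecidableEq V] [Field K]
    (D : V → V → Prop) (hacyc : ∀ v, ¬ Relation.TransGen D v v)
    (H : Matrix V V K) (hH : ∀ v w, ¬ D v w → H v w = 0)
    (r : ℕ) (x y : Fin r → V) (hx : Function.Injective x) (hy : Function.Injective y) :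
    IsUnit (1 - H) ∧
    ((1 - H)⁻¹.submatrix x y).det =
      ∑ᶠ P : PathSystem D r x y,
        ((Equiv.Perm.sign P.perm : ℤ) : K) * ∏ i, (P.path i).weight H ∧
    (IsEmpty (PathSystem D r x y) → ((1 - H)⁻¹.submatrix x y).det = 0) := by
  obtain ⟨G, hG, hsum⟩ := LGVAux.main D hacyc H hH r y _ Finset.univ rfl
  have hH' : (Matrix.of fun u v => if u ∈ (Finset.univ : Finset V) then H u v else 0) = H := by
    ext u v; simp
  rw [hH'] at hG
  have hmul : (1 - H) * G = 1 := by
    rw [sub_mul, one_mul, sub_eq_iff_eq_add]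
    exact hG
  have hinv : (1 - H)⁻¹ = G := Matrix.inv_eq_right_inv hmul
  have hdet : ((1 - H)⁻¹.submatrix x y).det =
      ∑ᶠ P : PathSystem D r x y,
        ((Equiv.Perm.sign P.perm : ℤ) : K) * ∏ i, (P.path i).weight H := by
    rw [hinv, (hsum x).2, ← finsum_set_coe_eq_finsum_mem]
    exact (finsum_eq_of_bijective LGVAux.toGood LGVAux.toGood_bij fun P => rfl).symm
  refine ⟨(Matrix.isUnit_iff_isUnit_det _).2 (Matrix.isUnit_det_of_right_inverse hmul), hdet, ?_⟩
  intro hE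
  rw [hdet, finsum_of_isEmpty]
end

section
/- With the generic frequency-domain parameterisation of an acyclic process graph G = (V, D), for all subsets X, Y ⊆ V with |X| = |Y| = r, the determinant det([(I−H)⁻¹]_{X,Y}) is nonzero as an element of the field 𝕂 if and only if there exists at least one system of non-intersecting directed paths from X to Y in G. -/
open Matrix
open scoped BigOperators

/-- The indeterminates of the generic parameterisation: `φ_{v,w,k}`, `ω_v` and `z`. -/
inductive GVar (V : Type u) : Type u
  | phi (v w : V) (k : ℕ)
  | omega (v : V)
  | z

/-- The field `𝕂 = ℝ(Φ, Ω, z)`: the field of fractions of the real polynomial ring in all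
the indeterminates `φ_{v,w,k}`, `ω_v` and `z`. -/
abbrev GField (V : Type u) : Type u := FractionRing (MvPolynomial (GVar V) ℝ)

/-- The image of an indeterminate in `𝕂`. -/
noncomputable def gv {V : Type*} (i : GVar V) : GField V :=
  algebraMap (MvPolynomial (GVar V) ℝ) (GField V) (MvPolynomial.X i)

/-- The image of a real constant in `𝕂`. -/
noncomputable def gconst {V : Type*} (a : ℝ) : GField V :=
  algebraMap (MvPolynomial (GVar V) ℝ) (GField V) (MvPolynomial.C a)

/-- The generic lag polynomial `φ_{v,w}(z) = Σ_{k ∈ K(v,w)} φ_{v,w,k}·z^k` in `𝕂`. -/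
noncomputable def lagPoly {V : Type*} (Kf : V × V → Finset ℕ) (v w : V) : GField V :=
  ∑ k ∈ Kf (v, w), gv (GVar.phi v w k) * gv GVar.z ^ k

/-- The generic direct transfer matrix `H` with `H_{v,w} = φ_{v,w}(z)/(1 − φ_{w,w}(z))` on
edges and `0` elsewhere. -/
noncomputable def Hmat {V : Type*} [DecidableEq V] (DO : Finset (V × V))
    (Kf : V × V → Finset ℕ) : Matrix V V (GField V) :=
  fun v w => if (v, w) ∈ DO then lagPoly Kf v w / (1 - lagPoly Kf w w) else 0

/-- The generic internal spectrum: the diagonal matrix with entries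
`ω_v/((1 − φ_{v,v}(z))·σ(1 − φ_{v,v}(z)))`. -/
noncomputable def SImat {V : Type*} [DecidableEq V] (Kf : V × V → Finset ℕ)
    (σ : GField V ≃+* GField V) : Matrix V V (GField V) :=
  Matrix.diagonal fun v =>
    gv (GVar.omega v) / ((1 - lagPoly Kf v v) * σ (1 - lagPoly Kf v v))

/-- The generic spectrum `S = ((I − H)ᵀ)⁻¹ · S^I · (I − H*)⁻¹`, where `H*` applies `σ`
entrywise to `H`. -/
noncomputable def Smat {V : Type*} [Fintype V] [DecidableEq V] (DO : Finset (V × V))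
    (Kf : V × V → Finset ℕ) (σ : GField V ≃+* GField V) : Matrix V V (GField V) :=
  ((1 - Hmat DO Kf)ᵀ)⁻¹ * SImat Kf σ * (1 - (Hmat DO Kf).map σ)⁻¹

section helpers

/-- Column block of indicator vectors. -/
def colInd {V : Type*} [DecidableEq V] (K : Type*) [CommRing K] {r : ℕ} (y : Fin r → V) :
    Matrix V (Fin r) K := fun v j => if v = y j then 1 else 0

/-- Row block of indicator vectors. -/
def rowInd {V : Type*} [DecidableEq V] (K : Type*) [CommRing K] {r : ℕ} (x : Fin r → V) :
    Matrix (Fin r) V K := fun i w => if w = x i then 1 else 0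

/-- The bordered matrix. -/
def bord {V : Type*} [DecidableEq V] {K : Type*} [CommRing K] {r : ℕ} (x y : Fin r → V)
    (M : Matrix V V K) : Matrix (V ⊕ Fin r) (V ⊕ Fin r) K :=
  Matrix.fromBlocks M (colInd K y) (rowInd K x) 0

theorem det_bord {V : Type*} [Fintype V] [DecidableEq V] {K : Type*} [Field K] {r : ℕ}
    (x y : Fin r → V) (M : Matrix V V K) (hM : M.det ≠ 0) :
    (bord x y M).det = M.det * (-(M⁻¹.submatrix x y)).det := by
  have hu : IsUnit M.det := isUnit_iff_ne_zero.mpr hM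
  let _ : Invertible M := Matrix.invertibleOfIsUnitDet M hu
  rw [bord, Matrix.det_fromBlocks₁₁, Matrix.invOf_eq_nonsing_inv]
  congr 2
  ext i j
  simp [Matrix.mul_apply, colInd, rowInd]

theorem det_bord_ne_zero_iff {V : Type*} [Fintype V] [DecidableEq V] {K : Type*} [Field K]
    {r : ℕ} (x y : Fin r → V) (M : Matrix V V K) (hM : M.det ≠ 0) :
    (bord x y M).det ≠ 0 ↔ (M⁻¹.submatrix x y).det ≠ 0 := by
  rw [det_bord x y M hM, Matrix.det_neg]
  simp [hM]

theorem pathSystem_of_perm {V : Type*} {E : V → V → Prop} {r : ℕ} {x y : Fin r → V}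
    [Finite V] (σ : Equiv.Perm (V ⊕ Fin r))
    (h1 : ∀ i, σ (Sum.inr i) = Sum.inl (x i))
    (h2 : ∀ v w, σ (Sum.inl v) = Sum.inl w → w = v ∨ E v w)
    (h3 : ∀ v j, σ (Sum.inl v) = Sum.inr j → v = y j) :
    Nonempty (PathSystem E r x y) := by
  classical
  have hex : ∀ i : Fin r, ∃ n, 0 < n ∧ ∃ j : Fin r, (σ ^ n) (Sum.inr i) = Sum.inr j := by
    intro i
    refine ⟨orderOf σ, orderOf_pos σ, i, ?_⟩
    rw [pow_orderOf_eq_one]; rfl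
  let n : Fin r → ℕ := fun i => Nat.find (hex i)
  have hn0 : ∀ i, 0 < n i := fun i => (Nat.find_spec (hex i)).1
  have hnj : ∀ i, ∃ j : Fin r, (σ ^ (n i)) (Sum.inr i) = Sum.inr j :=
    fun i => (Nat.find_spec (hex i)).2
  have hmin : ∀ i k, 0 < k → k < n i → ∀ j, (σ ^ k) (Sum.inr i) ≠ Sum.inr j := by
    intro i k hk hkn j hj
    exact Nat.find_min (hex i) hkn ⟨hk, j, hj⟩
  choose p hp using hnj
  let g : V ⊕ Fin r → V := Sum.elim id y
  have hg : ∀ i k, 0 < k → k < n i → (σ ^ k) (Sum.inr i) = Sum.inl (g ((σ ^ k) (Sum.inr i))) := by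
    intro i k hk hkn
    cases hc : (σ ^ k) (Sum.inr i) with
    | inl v => rfl
    | inr j => exact absurd hc (hmin i k hk hkn j)
  have hn2 : ∀ i, 2 ≤ n i := by
    intro i
    rcases Nat.lt_or_ge (n i) 2 with h | h
    · have h1' : n i = 1 := by have := hn0 i; omega
      have := hp i
      rw [h1', pow_one, h1] at this
      cases this
    · exact h
  -- key injectivity
  have hkey : ∀ i i' a b, a ≤ b → 0 < a → b ≤ n i' → (σ ^ a) (Sum.inr i) = (σ ^ b) (Sum.inr i') →
      i = i' ∧ a = b := by
    intro i i' a b hab ha hb h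
    have hb' : b = a + (b - a) := by omega
    rw [hb', pow_add, Equiv.Perm.mul_apply] at h
    have h' := (σ ^ a).injective h
    rcases Nat.eq_zero_or_pos (b - a) with h0 | h0
    · rw [h0] at h'
      refine ⟨by simpa using h', by omega⟩
    · exact absurd h'.symm (hmin i' (b - a) h0 (by omega) i)
  have hpinj : Function.Injective p := by
    intro i i' h
    have h' : (σ ^ (n i)) (Sum.inr i) = (σ ^ (n i')) (Sum.inr i') := by rw [hp, hp, h]
    rcases le_total (n i) (n i') with hl | hl
    · exact (hkey i i' _ _ hl (hn0 i) le_rfl h').1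
    · exact (hkey i' i _ _ hl (hn0 i') le_rfl h'.symm).1.symm
  let vs : Fin r → List V := fun i => (List.range (n i - 1)).map fun k => g ((σ ^ (k+1)) (Sum.inr i))
  have hlen : ∀ i, (vs i).length = n i - 1 := fun i => by simp [vs]
  have hne : ∀ i, vs i ≠ [] := by
    intro i h
    have := hlen i
    rw [h] at this
    have := hn2 i
    simp at *
    omega
  refine ⟨⟨fun i => ⟨vs i, hne i, ?_⟩, Equiv.ofBijective p (Finite.injective_iff_bijective.mp hpinj),
    ?_, ?_, ?_⟩⟩
  · refine List.isChain_iff_getElem.mpr ?_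
    intro k hk
    rw [hlen] at hk
    simp only [vs, List.getElem_map, List.getElem_range]
    have e1 := hg i (k+1) (by omega) (by omega)
    have e2 := hg i (k+1+1) (by omega) (by omega)
    have e3 : σ ((σ ^ (k+1)) (Sum.inr i)) = (σ ^ (k+1+1)) (Sum.inr i) := by
      rw [pow_succ' σ (k+1), Equiv.Perm.mul_apply]
    have e4 := e3
    rw [e1, e2] at e3
    rcases h2 _ _ e3 with h | h
    · exfalso
      rw [h, ← e1] at e2
      have := (hkey i i (k+1) (k+1+1) (by omega) (by omega) (by omega) e2.symm).2
      omega
    · exact h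
  · intro i
    simp only [DiPath.first, List.head_eq_getElem, vs, List.getElem_map, List.getElem_range]
    simp [h1, g]
  · intro i
    have := hn2 i
    simp only [DiPath.last, List.getLast_eq_getElem, vs, List.getElem_map, List.getElem_range,
      List.length_map, List.length_range, Equiv.ofBijective_apply]
    have e0 : n i - 1 - 1 + 1 = n i - 1 := by omega
    rw [e0]
    have e1 := hg i (n i - 1) (by omega) (by omega)
    apply h3
    rw [← e1, ← Equiv.Perm.mul_apply, ← pow_succ', ← hp i]
    congr 2
    omega
  · intro i j hij v hv hv'
    simp only [vs, List.mem_map, List.mem_range] at hv hv'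
    obtain ⟨a, ha, hav⟩ := hv
    obtain ⟨b, hb, hbv⟩ := hv'
    have e1 := hg i (a+1) (by omega) (by omega)
    have e2 := hg j (b+1) (by omega) (by omega)
    rw [hav] at e1
    rw [hbv] at e2
    have e := e1.trans e2.symm
    rcases le_total a b with hl | hl
    · exact hij (hkey i j _ _ (by omega) (by omega) (by omega) e).1
    · exact hij (hkey j i _ _ (by omega) (by omega) (by omega) e.symm).1.symm

theorem pathSystem_of_det {V : Type*} [Fintype V] [DecidableEq V] {K : Type*} [Field K] {r : ℕ}
    {x y : Fin r → V} {E : V → V → Prop} (H : Matrix V V K) (hH : ∀ v w, ¬ E v w → H v w = 0)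
    (h : (bord x y (1 - H)).det ≠ 0) : Nonempty (PathSystem E r x y) := by
  rw [Matrix.det_apply] at h
  obtain ⟨σ, -, hσ⟩ := Finset.exists_ne_zero_of_sum_ne_zero h
  have hσ' : ∀ i, bord x y (1 - H) (σ i) i ≠ 0 := by
    intro i hi
    apply hσ
    have h0 : ∏ i, bord x y (1 - H) (σ i) i = 0 :=
      Finset.prod_eq_zero (f := fun i => bord x y (1 - H) (σ i) i) (Finset.mem_univ i) hi
    rw [h0, smul_zero]
  have hτ : ∀ j k, σ.symm j = k → bord x y (1 - H) j k ≠ 0 := by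
    intro j k hjk
    have := hσ' k
    rwa [← hjk, Equiv.apply_symm_apply, hjk] at this
  refine pathSystem_of_perm σ.symm ?_ ?_ ?_
  · intro i
    cases hc : σ.symm (Sum.inr i) with
    | inl w =>
      have := hτ _ _ hc
      simp [bord, rowInd] at this
      rw [this]
    | inr j =>
      have := hτ _ _ hc
      simp [bord] at this
  · intro v w hc
    have := hτ _ _ hc
    by_contra hcon
    push Not at hcon
    apply this
    simp [bord, hH v w hcon.2, Matrix.one_apply_ne hcon.1.symm]
  · intro v j hc
    have := hτ _ _ hc
    simpa [bord, colInd] using this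

/-- Edge relation of a path system. -/
def PathSystem.used {V : Type*} {E : V → V → Prop} {r : ℕ} {x y : Fin r → V}
    (S : PathSystem E r x y) (v w : V) : Prop :=
  ∃ i k, ∃ h : k + 1 < (S.path i).verts.length,
    (S.path i).verts[k] = v ∧ (S.path i).verts[k+1] = w

theorem PathSystem.used_edge {V : Type*} {E : V → V → Prop} {r : ℕ} {x y : Fin r → V}
    (S : PathSystem E r x y) {v w : V} (h : S.used v w) : E v w := by
  obtain ⟨i, k, hk, rfl, rfl⟩ := h
  exact List.isChain_iff_getElem.mp (S.path i).chain k hk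

open Classical in
theorem det_bord_used {V : Type*} [Fintype V] {E : V → V → Prop}
    (hacyc : ∀ v : V, ¬ Relation.TransGen E v v) {r : ℕ}
    {x y : Fin r → V} (hy : Function.Injective y) (S : PathSystem E r x y) :
    (bord x y (1 - Matrix.of fun v w => if S.used v w then (1:ℝ) else 0)).det ≠ 0 := by
  have hnd : ∀ i, (S.path i).verts.Nodup := by
    intro i
    have h : List.IsChain (Relation.TransGen E) (S.path i).verts :=
      List.IsChain.imp (fun _ _ h => Relation.TransGen.single h) (S.path i).chain
    refine (List.isChain_iff_pairwise.mp h).imp ?_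
    rintro a b hab rfl
    exact hacyc a hab
  have huniq : ∀ i j k l (hk : k < (S.path i).verts.length) (hl : l < (S.path j).verts.length),
      (S.path i).verts[k] = (S.path j).verts[l] → i = j ∧ k = l := by
    intro i j k l hk hl h
    by_cases hij : i = j
    · subst hij
      exact ⟨rfl, (hnd i).getElem_inj_iff.mp h⟩
    · exact absurd (h ▸ List.getElem_mem hl) (S.disjoint i j hij _ (List.getElem_mem hk))
  intro hdet
  obtain ⟨c, hc0, hc⟩ := Matrix.exists_mulVec_eq_zero_iff.mpr hdet
  apply hc0
  set a : V → ℝ := fun v => c (Sum.inl v) with ha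
  set b : Fin r → ℝ := fun j => c (Sum.inr j) with hb
  have hrow : ∀ v, a v - (∑ w, if S.used v w then a w else 0) + (∑ j, if v = y j then b j else 0) = 0 := by
    intro v
    have := congrFun hc (Sum.inl v)
    simpa [bord, Matrix.mulVec, dotProduct, Fintype.sum_sum_type, colInd, sub_mul,
      Matrix.one_apply, Finset.sum_sub_distrib] using this
  have hx0 : ∀ i, a (x i) = 0 := by
    intro i
    have := congrFun hc (Sum.inr i)
    simpa [bord, Matrix.mulVec, dotProduct, Fintype.sum_sum_type, rowInd] using this
  have hpath : ∀ i k (hk : k < (S.path i).verts.length), a (S.path i).verts[k] = 0 := by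
    intro i k
    induction k with
    | zero =>
      intro hk
      have := S.first_eq i
      rw [DiPath.first, List.head_eq_getElem] at this
      rw [this, hx0]
    | succ k ih =>
      intro hk
      have h0 := hrow ((S.path i).verts[k])
      rw [ih (by omega)] at h0
      have hs1 : (∑ w, if S.used (S.path i).verts[k] w then a w else 0) = a (S.path i).verts[k+1] := by
        rw [Finset.sum_eq_single (S.path i).verts[k+1]]
        · rw [if_pos ⟨i, k, hk, rfl, rfl⟩]
        · intro w _ hw
          rw [if_neg]
          rintro ⟨j, l, hl, e1, e2⟩
          obtain ⟨rfl, rfl⟩ := huniq _ _ _ _ _ _ e1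
          exact hw e2.symm
        · simp
      have hs2 : (∑ j, if (S.path i).verts[k] = y j then b j else 0) = 0 := by
        apply Finset.sum_eq_zero
        intro j _
        rw [if_neg]
        intro e
        have hl := S.last_eq (S.perm.symm j)
        rw [Equiv.apply_symm_apply, DiPath.last, List.getLast_eq_getElem] at hl
        obtain ⟨rfl, h⟩ := huniq _ _ _ _ _ _ (e.trans hl.symm)
        omega
      rw [hs1, hs2] at h0
      linarith
  have hrow' : ∀ v, a v + (∑ j, if v = y j then b j else 0) = 0 := by
    intro v
    have h0 := hrow v
    rw [Finset.sum_eq_zero (s := Finset.univ) (f := fun w => if S.used v w then a w else 0)] at h0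
    · simpa using h0
    · intro w _
      split_ifs with h
      · obtain ⟨i, k, hk, _, rfl⟩ := h
        exact hpath _ _ _
      · rfl
  have hb0 : ∀ j, b j = 0 := by
    intro j
    have h0 := hrow' (y j)
    have hl := S.last_eq (S.perm.symm j)
    rw [Equiv.apply_symm_apply, DiPath.last, List.getLast_eq_getElem] at hl
    have ha0 : a (y j) = 0 := by rw [← hl]; exact hpath _ _ _
    rw [ha0] at h0
    simpa [hy.eq_iff] using h0
  have ha0 : ∀ v, a v = 0 := by
    intro v
    have h0 := hrow' v
    simpa [hb0] using h0
  funext s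
  cases s with
  | inl v => exact ha0 v
  | inr j => exact hb0 j

open MvPolynomial in
/-- Polynomial lag. -/
noncomputable def lagP {V : Type*} (Kf : V × V → Finset ℕ) (v w : V) : MvPolynomial (GVar V) ℝ :=
  ∑ k ∈ Kf (v, w), X (GVar.phi v w k) * X GVar.z ^ k

theorem algebraMap_lagP {V : Type*} (Kf : V × V → Finset ℕ) (v w : V) :
    algebraMap (MvPolynomial (GVar V) ℝ) (GField V) (lagP Kf v w) = lagPoly Kf v w := by
  simp [lagP, lagPoly, gv]

/-- Matrix with cleared denominators. -/
noncomputable def polM {V : Type*} [DecidableEq V] (DO : Finset (V × V))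
    (Kf : V × V → Finset ℕ) : Matrix V V (MvPolynomial (GVar V) ℝ) :=
  fun v w => (if v = w then 1 - lagP Kf w w else 0) - if (v, w) ∈ DO then lagP Kf v w else 0

open Classical in
/-- Specialisation point. -/
noncomputable def specPt {V : Type*} (U : V → V → Prop) (c : V × V → ℕ) : GVar V → ℝ
  | GVar.phi v w k => if U v w ∧ k = c (v, w) then 1 else 0
  | GVar.omega _ => 0
  | GVar.z => 1

open Classical in
theorem eval_lagP {V : Type*} (Kf : V × V → Finset ℕ) (U : V → V → Prop) (c : V × V → ℕ)
    (hU : ∀ v w, U v w → c (v, w) ∈ Kf (v, w)) (v w : V) :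
    MvPolynomial.eval (specPt U c) (lagP Kf v w) = if U v w then 1 else 0 := by
  simp only [lagP, map_sum, map_mul, map_pow, MvPolynomial.eval_X, specPt, one_pow, mul_one]
  by_cases h : U v w
  · simp [h, hU v w h]
  · simp [h]

open Classical in
theorem eval_polM {V : Type*} [DecidableEq V] (DO : Finset (V × V))
    (Kf : V × V → Finset ℕ) (U : V → V → Prop) (c : V × V → ℕ)
    (hU : ∀ v w, U v w → c (v, w) ∈ Kf (v, w)) (hUD : ∀ v w, U v w → (v, w) ∈ DO)
    (hirr : ∀ v, ¬ U v v) :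
    (polM DO Kf).map (MvPolynomial.eval (specPt U c)) =
      1 - Matrix.of fun v w => if U v w then (1:ℝ) else 0 := by
  ext v w
  simp only [Matrix.map_apply, polM, map_sub, apply_ite (MvPolynomial.eval (specPt U c)),
    eval_lagP Kf U c hU, map_zero, map_one, Matrix.sub_apply, Matrix.of_apply, Matrix.one_apply,
    hirr, if_false, sub_zero]
  congr 1
  by_cases h : U v w
  · simp [h, hUD v w h]
  · simp [h]

theorem map_bord {V : Type*} [DecidableEq V] {K L : Type*} [CommRing K] [CommRing L] {r : ℕ}
    (x y : Fin r → V) (M : Matrix V V K) (f : K →+* L) :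
    (bord x y M).map f = bord x y (M.map f) := by
  ext i j
  rcases i with i | i <;> rcases j with j | j <;> simp [bord, colInd, rowInd, apply_ite f]

end helpers

/-- in the generic frequency-domain parameterisation of an acyclic process
graph `G = (V, D)`, for equal-sized enumerated subsets `X, Y ⊆ V`, the determinant
`det([(I−H)⁻¹]_{X,Y})` is nonzero in `𝕂` if and only if there exists at least one system of
non-intersecting directed paths from `X` to `Y` in `G`. -/
theorem det_inv_one_sub_Hmat_ne_zero_iff
    {V : Type*} [Fintype V] [DecidableEq V]
    (DO : Finset (V × V)) (hDO : ∀ p ∈ DO, p.1 ≠ p.2)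
    (hacyc : ∀ v : V, ¬ Relation.TransGen (fun v w => (v, w) ∈ DO) v v)
    (Kf : V × V → Finset ℕ)
    (hKedge : ∀ p ∈ DO, (Kf p).Nonempty)
    (hKself : ∀ v : V, 0 ∉ Kf (v, v))
    (r : ℕ) (x y : Fin r → V) (hx : Function.Injective x) (hy : Function.Injective y) :
    ((1 - Hmat DO Kf)⁻¹.submatrix x y).det ≠ 0 ↔
      Nonempty (PathSystem (fun v w => (v, w) ∈ DO) r x y) := by
  classical
  have hEvDet : ∀ {n : Type _} [Fintype n] [DecidableEq n] (M : Matrix n n (MvPolynomial (GVar V) ℝ))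
      (s : GVar V → ℝ), (M.map (MvPolynomial.eval s)).det ≠ 0 →
      (M.map (algebraMap (MvPolynomial (GVar V) ℝ) (GField V))).det ≠ 0 := by
    intro n _ _ M s h h0
    apply h
    have e1 := RingHom.map_det (algebraMap (MvPolynomial (GVar V) ℝ) (GField V)) M
    have e2 := RingHom.map_det (MvPolynomial.eval s) M
    rw [RingHom.mapMatrix_apply] at e1 e2
    rw [h0] at e1
    have hM : M.det = 0 := (map_eq_zero_iff _ (IsFractionRing.injective _ _)).mp e1
    rw [← e2, hM, map_zero]
  set P : Matrix V V (GField V) :=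
    (polM DO Kf).map (algebraMap (MvPolynomial (GVar V) ℝ) (GField V)) with hP
  let d : V → GField V := fun w => 1 - lagPoly Kf w w
  have hd : ∀ w, d w ≠ 0 := by
    intro w h
    have e : d w = algebraMap (MvPolynomial (GVar V) ℝ) (GField V) (1 - lagP Kf w w) := by
      rw [map_sub, map_one, algebraMap_lagP]
    rw [e, map_eq_zero_iff _ (IsFractionRing.injective _ _)] at h
    have := congrArg (MvPolynomial.eval (specPt (fun _ _ => False) (fun _ => 0))) h
    rw [map_sub, eval_lagP Kf _ _ (fun _ _ h => h.elim)] at this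
    simp at this
  have hPM : P = (1 - Hmat DO Kf) * Matrix.diagonal d := by
    ext v w
    rw [Matrix.mul_diagonal, Matrix.sub_apply, sub_mul]
    simp only [hP, Matrix.map_apply, polM, map_sub, Hmat]
    congr 1
    · by_cases h : v = w
      · subst h
        simp [algebraMap_lagP, d]
      · simp [h]
    · by_cases h : (v, w) ∈ DO
      · simp only [h, if_true, algebraMap_lagP]
        exact (div_mul_cancel₀ _ (hd w)).symm
      · simp [h]
  have hPdet : P.det ≠ 0 := by
    apply hEvDet _ (specPt (fun _ _ => False) (fun _ => 0))
    rw [eval_polM DO Kf _ _ (fun _ _ h => h.elim) (fun _ _ h => h.elim) (fun _ h => h)]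
    have : ∀ A : Matrix V V ℝ, A = 0 → (1 - A).det ≠ 0 := by
      rintro A rfl
      rw [sub_zero, Matrix.det_one]
      exact one_ne_zero
    apply this
    ext v w
    simp
  have hMdet : (1 - Hmat DO Kf).det ≠ 0 := by
    rw [hPM, Matrix.det_mul] at hPdet
    exact left_ne_zero_of_mul hPdet
  constructor
  · intro h
    refine pathSystem_of_det (Hmat DO Kf) ?_ ((det_bord_ne_zero_iff x y _ hMdet).mpr h)
    intro v w hvw
    simp [Hmat, hvw]
  · rintro ⟨S⟩
    let c : V × V → ℕ := fun p => if h : (Kf p).Nonempty then h.choose else 0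
    have hc : ∀ p ∈ DO, c p ∈ Kf p := by
      intro p hp
      simp only [c, dif_pos (hKedge p hp)]
      exact (hKedge p hp).choose_spec
    have hB : (bord x y P).det ≠ 0 := by
      rw [hP, ← map_bord]
      apply hEvDet _ (specPt S.used c)
      rw [map_bord, eval_polM DO Kf S.used c (fun v w h => hc _ (S.used_edge h))
        (fun v w h => S.used_edge h) (fun v h => hDO _ (S.used_edge h) rfl)]
      convert det_bord_used hacyc hy S
    rw [det_bord_ne_zero_iff x y P hPdet] at hB
    have hinv : (1 - Hmat DO Kf)⁻¹ = Matrix.diagonal d * P⁻¹ := by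
      have hu : IsUnit (Matrix.diagonal d).det := by
        rw [Matrix.det_diagonal, isUnit_iff_ne_zero]
        exact Finset.prod_ne_zero_iff.mpr fun w _ => hd w
      rw [hPM, Matrix.mul_inv_rev, ← Matrix.mul_assoc, Matrix.mul_nonsing_inv _ hu, Matrix.one_mul]
    have hsub : (1 - Hmat DO Kf)⁻¹.submatrix x y =
        Matrix.diagonal (fun i => d (x i)) * P⁻¹.submatrix x y := by
      ext i j
      rw [hinv, Matrix.submatrix_apply, Matrix.diagonal_mul, Matrix.diagonal_mul,
        Matrix.submatrix_apply]
    rw [hsub, Matrix.det_mul, Matrix.det_diagonal]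
    exact mul_ne_zero (Finset.prod_ne_zero_iff.mpr fun i _ => hd _) hB
end

section
/- With the generic frequency-domain parameterisation of an acyclic process graph G = (V, D), for all subsets X, Y ⊆ V with |X| = |Y| = r, the determinant det([S]_{X,Y}) is zero as an element of the field 𝕂 if and only if every trek system from X to Y has a sided intersection (equivalently, there is no trek system from X to Y without sided intersection). -/
open Matrix
open scoped BigOperators

/-- A trek: a pair of directed paths with a common starting vertex (the top). -/
structure Trek {V : Type*} (E : V → V → Prop) where
  left : DiPath E
  right : DiPath E
  top_eq : left.first = right.first

/-- The top of a trek. -/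
def Trek.top {V : Type*} {E : V → V → Prop} (τ : Trek E) : V := τ.left.first

/-- A trek system without sided intersection from the enumerated set
`X = {x 0, …, x (r-1)}` to `Y = {y 0, …, y (r-1)}`: the `i`-th trek has Left-endpoint `x i`
and Right-endpoint `y (perm i)`, no two Left-paths share a vertex, and no two Right-paths
share a vertex. -/
structure TrekSystem {V : Type*} (E : V → V → Prop) (r : ℕ) (x y : Fin r → V) where
  trek : Fin r → Trek E
  perm : Equiv.Perm (Fin r)
  left_last : ∀ i, (trek i).left.last = x i
  right_last : ∀ i, (trek i).right.last = y (perm i)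
  left_disj : ∀ i j, i ≠ j → ∀ v ∈ (trek i).left.verts, v ∉ (trek j).left.verts
  right_disj : ∀ i j, i ≠ j → ∀ v ∈ (trek i).right.verts, v ∉ (trek j).right.verts


theorem aux_exists_perm {W F : Type*} [Fintype W] [DecidableEq W] [Field F] {r : ℕ}
    (N B : Matrix W W F) (hB : B * N = 1) (p q : Fin r → W) (hq : Function.Injective q)
    (h : (B.submatrix p q).det ≠ 0) :
    ∃ π : Equiv.Perm W, (∀ i, π (q i) = p i) ∧ ∀ v, v ∉ Set.range q → N v (π v) ≠ 0 := by
  classical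
  let N' : Matrix W W F := fun v w =>
    if h : ∃ i, q i = v then (if w = p h.choose then 1 else 0) else N v w
  have hN'q : ∀ i w, N' (q i) w = if w = p i then 1 else 0 := by
    intro i w
    have h : ∃ j, q j = q i := ⟨i, rfl⟩
    have h2 : h.choose = i := hq h.choose_spec
    simp only [N']
    rw [dif_pos h, h2]
  have hN'n : ∀ v, v ∉ Set.range q → ∀ w, N' v w = N v w := by
    intro v hv w
    simp only [N']
    rw [dif_neg (by simpa using hv)]
  have hdet : N'ᵀ.det ≠ 0 := by
    rw [det_transpose]
    intro h0
    obtain ⟨b, hb0, hb⟩ := Matrix.exists_mulVec_eq_zero_iff.2 h0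
    apply hb0
    have hbp : ∀ i, b (p i) = 0 := by
      intro i
      have := congrFun hb (q i)
      simpa [Matrix.mulVec, dotProduct, hN'q] using this
    have hc : ∀ v, v ∉ Set.range q → (N *ᵥ b) v = 0 := by
      intro v hv
      have := congrFun hb v
      simpa [Matrix.mulVec, dotProduct, hN'n v hv] using this
    have hbB : B *ᵥ (N *ᵥ b) = b := by
      rw [Matrix.mulVec_mulVec, hB, Matrix.one_mulVec]
    have hsum : ∀ v, (B *ᵥ (N *ᵥ b)) v = ∑ j, B v (q j) * (N *ᵥ b) (q j) := by
      intro v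
      rw [Matrix.mulVec, dotProduct]
      rw [← Finset.sum_image (s := Finset.univ) (g := q)
        (f := fun w => B v w * (N *ᵥ b) w) (by intro a _ b _ h; exact hq h)]
      symm
      apply Finset.sum_subset (Finset.subset_univ _)
      intro w _ hw
      rw [hc w (by simpa using hw), mul_zero]
    have hz : (fun j => (N *ᵥ b) (q j)) = 0 := by
      by_contra hne
      apply h
      apply Matrix.exists_mulVec_eq_zero_iff.1
      refine ⟨_, hne, ?_⟩
      ext i
      have := hsum (p i)
      rw [hbB, hbp] at this
      simpa [Matrix.mulVec, dotProduct] using this.symm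
    ext v
    rw [← hbB, hsum]
    apply Finset.sum_eq_zero
    intro j _
    rw [congrFun hz j]
    simp
  rw [Matrix.det_apply] at hdet
  obtain ⟨s, _, hs⟩ := Finset.exists_ne_zero_of_sum_ne_zero hdet
  have hs' : ∏ i, N'ᵀ (s i) i ≠ 0 := by
    intro h0
    rw [h0] at hs
    simp at hs
  rw [Finset.prod_ne_zero_iff] at hs'
  refine ⟨s, ?_, ?_⟩
  · intro i
    have := hs' (q i) (Finset.mem_univ _)
    rw [Matrix.transpose_apply, hN'q] at this
    by_contra hne
    simp [hne] at this
  · intro v hv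
    have := hs' v (Finset.mem_univ _)
    rwa [Matrix.transpose_apply, hN'n v hv] at this

theorem aux_exists_paths {W : Type*} [Finite W] {r : ℕ} (R : W → W → Prop)
    (p q : Fin r → W) (hq : Function.Injective q) (π : Equiv.Perm W)
    (hπ : ∀ i, π (q i) = p i) (hR : ∀ v, v ∉ Set.range q → π v = v ∨ R v (π v)) :
    ∃ (l : Fin r → List W) (s : Equiv.Perm (Fin r)),
      (∀ i, (l i).head? = some (p i)) ∧ (∀ i, (l i).getLast? = some (q (s i))) ∧
      (∀ i, (l i).IsChain R) ∧ ∀ i j, i ≠ j → ∀ v ∈ l i, v ∉ l j := by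
  classical
  have hp : Function.Injective p := by
    intro i j h
    apply hq
    apply π.injective
    rw [hπ, hπ, h]
  have hex : ∀ i, ∃ n : ℕ, (π ^ n) (p i) ∈ Set.range q := by
    intro i
    obtain ⟨n, hn, h1⟩ := (isOfFinOrder_of_finite π).exists_pow_eq_one
    refine ⟨n - 1, i, ?_⟩
    rw [← hπ, ← Equiv.Perm.mul_apply, ← pow_succ, Nat.sub_add_cancel hn, h1]
    rfl
  let n : Fin r → ℕ := fun i => Nat.find (hex i)
  have hn : ∀ i, (π ^ (n i)) (p i) ∈ Set.range q := fun i => Nat.find_spec (hex i)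
  have hmin : ∀ i k, k < n i → (π ^ k) (p i) ∉ Set.range q := fun i k hk => Nat.find_min (hex i) hk
  have hdis' : ∀ i j a b, b ≤ n j → a ≤ b → (π ^ a) (p i) = (π ^ b) (p j) → i = j := by
    intro i j a b hb hab h
    obtain ⟨c, rfl⟩ := Nat.exists_eq_add_of_le hab
    rw [pow_add, Equiv.Perm.mul_apply] at h
    have h := (π ^ a).injective h
    rcases c with _ | c
    · exact hp h
    · exfalso
      apply hmin j c (by omega)
      refine ⟨i, ?_⟩
      apply π.injective
      rw [hπ, h, pow_succ', Equiv.Perm.mul_apply]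
  have hdis : ∀ i j a b, a ≤ n i → b ≤ n j → (π ^ a) (p i) = (π ^ b) (p j) → i = j := by
    intro i j a b ha hb h
    rcases le_total a b with hab | hab
    · exact hdis' i j a b hb hab h
    · exact (hdis' j i b a ha hab h.symm).symm
  choose s hs using hn
  have hsinj : Function.Injective s := by
    intro i j h
    apply hdis i j (n i) (n j) le_rfl le_rfl
    rw [← hs, ← hs, h]
  refine ⟨fun i => (List.range (n i + 1)).map (fun k => (π ^ k) (p i)),
    Equiv.ofBijective s (Finite.injective_iff_bijective.1 hsinj), ?_, ?_, ?_, ?_⟩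
  · intro i
    simp [List.range_succ_eq_map]
  · intro i
    simp [List.range_succ, hs]
  · intro i
    rw [List.isChain_iff_getElem]
    intro k hk
    simp only [List.length_map, List.length_range] at hk
    simp only [List.getElem_map, List.getElem_range]
    have h1 := hmin i k (by omega)
    rcases hR _ h1 with h2 | h2
    · exfalso
      rw [← Equiv.Perm.mul_apply, ← pow_succ', pow_succ, Equiv.Perm.mul_apply] at h2
      have h3 := (π ^ k).injective h2
      have h4 : q i = p i := by
        apply π.injective
        rw [hπ, h3]
      apply hmin i 0 (by omega)
      exact ⟨i, by simpa using h4⟩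
    · rwa [pow_succ', Equiv.Perm.mul_apply]
  · intro i j hij v hv hv'
    simp only [List.mem_map, List.mem_range] at hv hv'
    obtain ⟨a, ha, rfl⟩ := hv
    obtain ⟨b, hb, h⟩ := hv'
    exact hij (hdis i j a b (by omega) (by omega) h.symm)

theorem aux_det_one_sub {V F : Type*} [Fintype V] [DecidableEq V] [Field F] (E : V → V → Prop)
    (hacyc : ∀ v : V, ¬ Relation.TransGen E v v) (A : Matrix V V F)
    (hA : ∀ v w, A v w ≠ 0 → E v w) : (1 - A).det ≠ 0 := by
  intro h0
  obtain ⟨b, hb0, hb⟩ := Matrix.exists_mulVec_eq_zero_iff.2 h0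
  rw [Matrix.sub_mulVec, Matrix.one_mulVec, sub_eq_zero] at hb
  let R : V → V → Prop := fun w v => Relation.TransGen E v w
  have : IsTrans V R := ⟨fun a b c h1 h2 => Relation.TransGen.trans h2 h1⟩
  have : Std.Irrefl R := ⟨fun a h => hacyc a h⟩
  have wf : WellFounded R := Finite.wellFounded_of_trans_of_irrefl R
  apply hb0
  ext v
  induction v using wf.induction with
  | _ v ih =>
    rw [congrFun hb v]
    apply Finset.sum_eq_zero
    intro w _
    by_cases h : A v w = 0
    · simp [h]
    · rw [ih w (Relation.TransGen.single (hA v w h))]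
      simp

theorem aux_right {V : Type*} {E : V → V → Prop} (R : V ⊕ V → V ⊕ V → Prop)
    (hLR : ∀ a b, ¬ R (Sum.inr a) (Sum.inl b))
    (hRR : ∀ a b, R (Sum.inr a) (Sum.inr b) → E a b) (b : V) :
    ∀ (l : List (V ⊕ V)) (a : V), (Sum.inr a :: l).IsChain R →
      (Sum.inr a :: l).getLast? = some (Sum.inr b) →
      ∃ P : DiPath E, P.first = a ∧ P.last = b ∧
        ∀ v ∈ P.verts, Sum.inr v ∈ (Sum.inr a :: l) := by
  intro l
  induction l with
  | nil =>
    intro a _ h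
    simp at h
    subst h
    exact ⟨⟨[a], by simp, List.isChain_singleton a⟩, rfl, rfl, by simp⟩
  | cons d l ih =>
    intro a hc h
    rw [List.isChain_cons_cons] at hc
    rcases d with d | d
    · exact absurd hc.1 (hLR _ _)
    · obtain ⟨P, h1, h2, h3⟩ := ih d hc.2 (by rwa [List.getLast?_cons_cons] at h)
      refine ⟨⟨a :: P.verts, by simp, ?_⟩, rfl, ?_, ?_⟩
      · change List.IsChain E _
        rw [List.isChain_cons]
        refine ⟨?_, P.chain⟩
        intro y hy
        have : y = d := by
          rw [List.head?_eq_some_head P.ne] at hy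
          simp at hy
          rw [← hy]
          exact h1
        rw [this]
        exact hRR _ _ hc.1
      · simp only [DiPath.last]
        rw [List.getLast_cons P.ne]
        exact h2
      · intro v hv
        rcases List.mem_cons.1 hv with rfl | hv
        · simp
        · exact List.mem_cons_of_mem _ (h3 v hv)

theorem aux_trek {V : Type*} {E : V → V → Prop} (R : V ⊕ V → V ⊕ V → Prop)
    (hLL : ∀ a b, R (Sum.inl a) (Sum.inl b) → E b a)
    (hM : ∀ a b, R (Sum.inl a) (Sum.inr b) → a = b)
    (hLR : ∀ a b, ¬ R (Sum.inr a) (Sum.inl b))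
    (hRR : ∀ a b, R (Sum.inr a) (Sum.inr b) → E a b) (b : V) :
    ∀ (l : List (V ⊕ V)) (a : V), (Sum.inl a :: l).IsChain R →
      (Sum.inl a :: l).getLast? = some (Sum.inr b) →
      ∃ τ : Trek E, τ.left.last = a ∧ τ.right.last = b ∧
        (∀ v ∈ τ.left.verts, Sum.inl v ∈ (Sum.inl a :: l)) ∧
        ∀ v ∈ τ.right.verts, Sum.inr v ∈ (Sum.inl a :: l) := by
  intro l
  induction l with
  | nil =>
    intro a _ h
    simp at h
  | cons d l ih =>
    intro a hc h
    rw [List.isChain_cons_cons] at hc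
    rw [List.getLast?_cons_cons] at h
    rcases d with d | d
    · obtain ⟨τ, h1, h2, h3, h4⟩ := ih d hc.2 h
      refine ⟨⟨⟨τ.left.verts ++ [a], by simp, ?_⟩, τ.right, ?_⟩, ?_, h2, ?_, ?_⟩
      · change List.IsChain E _
        rw [List.isChain_append]
        refine ⟨τ.left.chain, List.isChain_singleton a, ?_⟩
        intro x hx y hy
        have hx' : x = d := by
          rw [List.getLast?_eq_some_getLast τ.left.ne] at hx
          simp at hx
          rw [← hx]
          exact h1
        have hy' : y = a := by simpa using hy.symm
        rw [hx', hy']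
        exact hLL _ _ hc.1
      · rw [← τ.top_eq]
        simp only [DiPath.first]
        rw [List.head_append_of_ne_nil]
      · simp [DiPath.last]
      · intro v hv
        rcases List.mem_append.1 hv with hv | hv
        · exact List.mem_cons_of_mem _ (h3 v hv)
        · have : v = a := by simpa using hv
          simp [this]
      · intro v hv
        exact List.mem_cons_of_mem _ (h4 v hv)
    · obtain ⟨P, h1, h2, h3⟩ := aux_right R hLR hRR b l d hc.2 h
      have := hM _ _ hc.1
      subst this
      refine ⟨⟨⟨[a], by simp, List.isChain_singleton a⟩, P, by rw [h1]; rfl⟩, rfl, h2, ?_, ?_⟩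
      · intro v hv
        have : v = a := by simpa using hv
        simp [this]
      · intro v hv
        exact List.mem_cons_of_mem _ (h3 v hv)

theorem aux_trekSystem {V F : Type*} [Fintype V] [DecidableEq V] [Field F] (E : V → V → Prop)
    (A C D LA LC : Matrix V V F) (hA : ∀ v w, v ≠ w → A v w ≠ 0 → E w v)
    (hC : ∀ v w, v ≠ w → C v w ≠ 0 → E v w)
    (hD : ∀ v w, v ≠ w → D v w = 0) (hLA : LA * A = 1) (hLC : LC * C = 1)
    {r : ℕ} (x y : Fin r → V)
    (hy : Function.Injective y)
    (hdet : ((LA * D * LC).submatrix x y).det ≠ 0) : Nonempty (TrekSystem E r x y) := by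
  let N : Matrix (V ⊕ V) (V ⊕ V) F := fromBlocks A (-D) 0 C
  let B : Matrix (V ⊕ V) (V ⊕ V) F := fromBlocks LA (LA * D * LC) 0 LC
  have hB : B * N = 1 := by
    simp only [B, N]
    rw [fromBlocks_multiply]
    simp [hLA, hLC, Matrix.mul_assoc]
  have hdet' : (B.submatrix (fun i => Sum.inl (x i)) (fun i => Sum.inr (y i))).det ≠ 0 := hdet
  obtain ⟨π, h1, h2⟩ := aux_exists_perm N B hB (fun i => Sum.inl (x i)) (fun i => Sum.inr (y i))
    (fun i j h => hy (Sum.inr_injective h)) hdet'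
  let R : V ⊕ V → V ⊕ V → Prop := fun v w => v ≠ w ∧ N v w ≠ 0
  obtain ⟨l, s, hl1, hl2, hl3, hl4⟩ := aux_exists_paths R _ _
    (fun i j h => hy (Sum.inr_injective h)) π h1 (by
      intro v hv
      by_cases h : π v = v
      · exact Or.inl h
      · exact Or.inr ⟨fun h' => h h'.symm, h2 v hv⟩)
  have key : ∀ i, ∃ τ : Trek E, τ.left.last = x i ∧ τ.right.last = y (s i) ∧
        (∀ v ∈ τ.left.verts, Sum.inl v ∈ l i) ∧
        ∀ v ∈ τ.right.verts, Sum.inr v ∈ l i := by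
    intro i
    obtain ⟨t, ht⟩ : ∃ t, l i = Sum.inl (x i) :: t := by
      have := hl1 i
      rw [List.head?_eq_some_iff] at this
      exact this
    rw [ht]
    apply aux_trek R
    · rintro a b ⟨h, h'⟩
      exact hA _ _ (fun h2 => h (by rw [h2])) h'
    · rintro a b ⟨h, h'⟩
      by_contra hne
      apply h'
      simp [N, hD a b hne]
    · rintro a b ⟨h, h'⟩
      exact h' rfl
    · rintro a b ⟨h, h'⟩
      exact hC _ _ (fun h2 => h (by rw [h2])) h'
    · rw [← ht]; exact hl3 i
    · rw [← ht]; exact hl2 i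
  choose τ k1 k2 k3 k4 using key
  exact ⟨⟨τ, s, k1, k2, fun i j hij v hv hv' => hl4 i j hij _ (k3 i v hv) (k3 j v hv'),
    fun i j hij v hv hv' => hl4 i j hij _ (k4 i v hv) (k4 j v hv')⟩⟩

/-- The weight-one adjacency matrix of a disjoint path system. -/
theorem aux_adj {V : Type*} [Fintype V] [DecidableEq V] (E : V → V → Prop)
    (hacyc : ∀ v : V, ¬ Relation.TransGen E v v) {r : ℕ} (P : Fin r → DiPath E)
    (hdis : ∀ i j, i ≠ j → ∀ v ∈ (P i).verts, v ∉ (P j).verts) :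
    ∃ U : V → V → Prop, (∀ v w, U v w → E v w) ∧
      ∀ A : Matrix V V ℝ, (∀ v w, U v w → A v w = 1) → (∀ v w, ¬ U v w → A v w = 0) →
        (1 - A).det ≠ 0 ∧
        ((1 - A).adjugate.submatrix (fun i => (P i).first) (fun i => (P i).last)).det ≠ 0 := by
  classical
  let U : V → V → Prop := fun v w => ∃ i, ∃ n, ∃ h : n + 1 < (P i).verts.length,
    (P i).verts[n] = v ∧ (P i).verts[n+1] = w
  have hUE : ∀ v w, U v w → E v w := by
    rintro v w ⟨i, n, h, rfl, rfl⟩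
    exact List.isChain_iff_getElem.1 (P i).chain n h
  refine ⟨U, hUE, ?_⟩
  intro A hA1 hA0
  have hdet : (1 - A).det ≠ 0 := by
    apply aux_det_one_sub E hacyc
    intro v w h
    by_contra hE
    exact h (hA0 v w (fun hU => hE (hUE v w hU)))
  refine ⟨hdet, ?_⟩
  have hnodup : ∀ i, (P i).verts.Nodup := by
    intro i
    have h1 : List.IsChain (Relation.TransGen E) (P i).verts :=
      List.IsChain.imp (fun a b h => Relation.TransGen.single h) (P i).chain
    have h2 := h1.pairwise
    refine h2.imp ?_
    rintro a b h rfl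
    exact hacyc a h
  let b : Fin r → V → ℝ := fun j v => if v ∈ (P j).verts then 1 else 0
  have hb : ∀ j, (1 - A) *ᵥ (b j) = Pi.single ((P j).last) 1 := by
    intro j
    rw [Matrix.sub_mulVec, Matrix.one_mulVec]
    ext v
    simp only [Pi.sub_apply]
    by_cases hv : v ∈ (P j).verts
    · obtain ⟨n, hn, hnv⟩ := List.getElem_of_mem hv
      have hbv : b j v = 1 := by simp [b, hv]
      by_cases hlast : n + 1 < (P j).verts.length
      · have hsum : (A *ᵥ b j) v = 1 := by
          rw [Matrix.mulVec, dotProduct, Finset.sum_eq_single ((P j).verts[n+1])]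
          · rw [hA1 _ _ ⟨j, n, hlast, hnv, rfl⟩]
            simp [b]
          · intro w _ hw
            rw [hA0, zero_mul]
            rintro ⟨i, m, hm, h1, h2⟩
            have hij : i = j := by
              by_contra hij
              exact hdis i j hij v (h1 ▸ List.getElem_mem _) hv
            subst hij
            have : m = n := by
              apply (List.Nodup.getElem_inj_iff (hnodup i)).1 (h1.trans hnv.symm)
            subst this
            exact hw h2.symm
          · simp
        rw [hbv, hsum, sub_self]
        rw [Pi.single_apply, if_neg]
        intro h
        rw [DiPath.last, List.getLast_eq_getElem, ← hnv] at h
        have := (List.Nodup.getElem_inj_iff (hnodup j)).1 h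
        omega
      · have hvl : v = (P j).last := by
          rw [DiPath.last, List.getLast_eq_getElem, ← hnv]
          congr 1
          omega
        have hsum : (A *ᵥ b j) v = 0 := by
          rw [Matrix.mulVec, dotProduct]
          apply Finset.sum_eq_zero
          intro w _
          rw [hA0, zero_mul]
          rintro ⟨i, m, hm, h1, h2⟩
          have hij : i = j := by
            by_contra hij
            exact hdis i j hij v (h1 ▸ List.getElem_mem _) hv
          subst hij
          have : m = n := by
            apply (List.Nodup.getElem_inj_iff (hnodup i)).1 (h1.trans hnv.symm)
          omega
        rw [hbv, hsum, ← hvl]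
        simp
    · have hbv : b j v = 0 := by simp [b, hv]
      have hsum : (A *ᵥ b j) v = 0 := by
        rw [Matrix.mulVec, dotProduct]
        apply Finset.sum_eq_zero
        intro w _
        by_cases hw : w ∈ (P j).verts
        · rw [hA0, zero_mul]
          rintro ⟨i, m, hm, h1, h2⟩
          have hij : i = j := by
            by_contra hij
            exact hdis i j hij w (h2 ▸ List.getElem_mem _) hw
          subst hij
          exact hv (h1 ▸ List.getElem_mem _)
        · simp [b, hw]
      rw [hbv, hsum, Pi.single_apply, if_neg, sub_zero]
      rintro rfl
      exact hv (List.getLast_mem _)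
  have hadj : ∀ j v, (1 - A).adjugate v (P j).last = (1 - A).det * b j v := by
    intro j v
    have h1 : (1 - A).adjugate *ᵥ ((1 - A) *ᵥ (b j)) = (1 - A).det • b j := by
      rw [Matrix.mulVec_mulVec, Matrix.adjugate_mul, Matrix.smul_mulVec, Matrix.one_mulVec]
    rw [hb j] at h1
    have := congrFun h1 v
    simpa using this
  have heq : (1 - A).adjugate.submatrix (fun i => (P i).first) (fun i => (P i).last)
      = (1 - A).det • (1 : Matrix (Fin r) (Fin r) ℝ) := by
    ext i j
    rw [Matrix.submatrix_apply, hadj, Matrix.smul_apply, smul_eq_mul]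
    congr 1
    by_cases hij : i = j
    · subst hij
      simp only [b, Matrix.one_apply_eq]
      rw [if_pos]
      exact List.head_mem _
    · rw [Matrix.one_apply_ne hij]
      simp only [b]
      rw [if_neg]
      exact hdis i j hij _ (List.head_mem _)
  rw [heq, Matrix.det_smul, Matrix.det_one, mul_one]
  exact pow_ne_zero _ hdet

/-- The lag polynomial before passing to the fraction field. -/
noncomputable def auxLag {V : Type*} (Kf : V × V → Finset ℕ) (v w : V) :
    MvPolynomial (GVar V) ℝ :=
  ∑ k ∈ Kf (v, w), MvPolynomial.X (GVar.phi v w k) * MvPolynomial.X GVar.z ^ k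

theorem auxLag_map {V : Type*} (Kf : V × V → Finset ℕ) (v w : V) :
    algebraMap (MvPolynomial (GVar V) ℝ) (GField V) (auxLag Kf v w) = lagPoly Kf v w := by
  simp [auxLag, lagPoly, gv, map_sum]

theorem aux_one_sub_lag {V : Type*} (Kf : V × V → Finset ℕ) (v : V) :
    (1 - lagPoly Kf v v : GField V) ≠ 0 := by
  rw [← auxLag_map, ← map_one (algebraMap (MvPolynomial (GVar V) ℝ) (GField V)), ← map_sub]
  intro h
  have h := (map_eq_zero_iff _ (IsFractionRing.injective (MvPolynomial (GVar V) ℝ) (GField V))).1 h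
  have h := congrArg (MvPolynomial.eval (fun _ => (0 : ℝ))) h
  simp [auxLag, map_sum] at h

theorem aux_map_inv {V F G : Type*} [Fintype V] [DecidableEq V] [Field F] [Field G]
    (ρ : F →+* G) (A : Matrix V V F) (h : A.det ≠ 0) : (A⁻¹).map ρ = (A.map ρ)⁻¹ := by
  symm
  apply Matrix.inv_eq_right_inv
  rw [← Matrix.map_mul, Matrix.mul_nonsing_inv _ (isUnit_iff_ne_zero.2 h)]
  exact Matrix.map_one _ (map_zero ρ) (map_one ρ)

theorem aux_L_ne {V : Type*} [Fintype V] [DecidableEq V]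
    (DO : Finset (V × V)) (hDO : ∀ p ∈ DO, p.1 ≠ p.2)
    (hacyc : ∀ v : V, ¬ Relation.TransGen (fun v w => (v, w) ∈ DO) v v)
    (Kf : V × V → Finset ℕ)
    (hKedge : ∀ p ∈ DO, (Kf p).Nonempty) {r : ℕ} (P : Fin r → DiPath (fun v w => (v, w) ∈ DO))
    (hdis : ∀ i j, i ≠ j → ∀ v ∈ (P i).verts, v ∉ (P j).verts) :
    ((1 - Hmat DO Kf)⁻¹.submatrix (fun i => (P i).first) (fun i => (P i).last)).det ≠ 0 := by
  classical
  obtain ⟨U, hUE, hU⟩ := aux_adj _ hacyc P hdis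
  let ι := algebraMap (MvPolynomial (GVar V) ℝ) (GField V)
  have hι : Function.Injective ι := IsFractionRing.injective _ _
  let M : Matrix V V (MvPolynomial (GVar V) ℝ) := fun v w =>
    (if v = w then 1 - auxLag Kf w w else 0) - if (v, w) ∈ DO then auxLag Kf v w else 0
  let val : GVar V → ℝ := fun g => match g with
    | GVar.phi v w k => if h : U v w then
        (if k = (hKedge (v, w) (hUE v w h)).choose then 1 else 0) else 0
    | GVar.omega _ => 0
    | GVar.z => 1
  let e : MvPolynomial (GVar V) ℝ →+* ℝ := MvPolynomial.eval val
  have he1 : ∀ v w, U v w → e (auxLag Kf v w) = 1 := by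
    intro v w h
    simp only [e, auxLag, map_sum, map_mul, map_pow, MvPolynomial.eval_X]
    simp only [val, dif_pos h]
    simp [(hKedge (v, w) (hUE v w h)).choose_spec]
  have he0 : ∀ v w, ¬ U v w → e (auxLag Kf v w) = 0 := by
    intro v w h
    simp only [e, auxLag, map_sum, map_mul, map_pow, MvPolynomial.eval_X]
    simp only [val, dif_neg h]
    simp
  let A : Matrix V V ℝ := fun v w => if U v w then 1 else 0
  have hself : ∀ v, ¬ U v v := fun v h => hDO _ (hUE v v h) rfl
  have hMe : e.mapMatrix M = 1 - A := by
    ext v w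
    change e ((if v = w then 1 - auxLag Kf w w else 0) - if (v, w) ∈ DO then auxLag Kf v w else 0)
      = (1 : Matrix V V ℝ) v w - (if U v w then 1 else 0)
    rw [Matrix.one_apply, map_sub]
    congr 1
    · split_ifs with h
      · rw [map_sub, map_one, he0 _ _ (hself w), sub_zero]
      · simp
    · by_cases hUvw : U v w
      · rw [if_pos (hUE v w hUvw), he1 v w hUvw, if_pos hUvw]
      · rw [if_neg hUvw]
        split_ifs
        · exact he0 v w hUvw
        · simp
  obtain ⟨hd1, hd2⟩ := hU A (fun v w h => if_pos h) (fun v w h => if_neg h)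
  have hMdet : M.det ≠ 0 := by
    intro h
    apply hd1
    rw [← hMe, ← RingHom.map_det, h, map_zero]
  have hMadj : (M.adjugate.submatrix (fun i => (P i).first) (fun i => (P i).last)).det ≠ 0 := by
    intro h
    apply hd2
    rw [← hMe, ← RingHom.map_adjugate]
    have h2 := RingHom.map_det e
      (M.adjugate.submatrix (fun i => (P i).first) (fun i => (P i).last))
    rw [h, map_zero] at h2
    exact h2.symm
  let u : V → GField V := fun v => 1 - lagPoly Kf v v
  have hu : ∀ v, u v ≠ 0 := fun v => aux_one_sub_lag Kf v
  let d : GField V := ι M.det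
  have hd : d ≠ 0 := fun h => hMdet ((map_eq_zero_iff _ hι).1 h)
  have hHM : (1 - Hmat DO Kf) * diagonal u = ι.mapMatrix M := by
    ext v w
    rw [Matrix.mul_diagonal]
    change ((1 : Matrix V V (GField V)) v w -
        (if (v, w) ∈ DO then lagPoly Kf v w / (1 - lagPoly Kf w w) else 0)) * u w =
      ι ((if v = w then 1 - auxLag Kf w w else 0) - if (v, w) ∈ DO then auxLag Kf v w else 0)
    rw [Matrix.one_apply, map_sub, sub_mul]
    congr 1
    · split_ifs with h
      · rw [map_sub, map_one, auxLag_map, one_mul]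
      · simp
    · split_ifs with h
      · rw [auxLag_map]
        exact div_mul_cancel₀ _ (hu w)
      · simp
  have hinv : (1 - Hmat DO Kf)⁻¹ = diagonal u * (d⁻¹ • ι.mapMatrix M.adjugate) := by
    apply Matrix.inv_eq_right_inv
    rw [← Matrix.mul_assoc, hHM, RingHom.map_adjugate, Matrix.mul_smul, Matrix.mul_adjugate,
      ← RingHom.map_det, smul_smul, inv_mul_cancel₀ hd, one_smul]
  have hsub : (1 - Hmat DO Kf)⁻¹.submatrix (fun i => (P i).first) (fun i => (P i).last)
      = diagonal (fun i => u (P i).first * d⁻¹) *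
        ι.mapMatrix (M.adjugate.submatrix (fun i => (P i).first) (fun i => (P i).last)) := by
    rw [hinv]
    ext i j
    rw [Matrix.submatrix_apply, Matrix.diagonal_mul, Matrix.diagonal_mul]
    simp only [Matrix.smul_apply, RingHom.mapMatrix_apply, Matrix.map_apply, smul_eq_mul,
      Matrix.submatrix_apply]
    ring
  rw [hsub, Matrix.det_mul, Matrix.det_diagonal, ← RingHom.map_det]
  refine mul_ne_zero ?_ ?_
  · rw [Finset.prod_ne_zero_iff]
    intro i _
    exact mul_ne_zero (hu _) (inv_ne_zero hd)
  · exact fun h => hMadj ((map_eq_zero_iff _ hι).1 h)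

theorem aux_scale {V : Type*} (c : V → ℝ) (hc : ∀ v, c v ≠ 0) :
    ∃ ρ : GField V →+* GField V, (∀ v w k, ρ (gv (GVar.phi v w k)) = gv (GVar.phi v w k)) ∧
      ρ (gv GVar.z) = gv GVar.z ∧
      ∀ v, ρ (gv (GVar.omega v)) = gconst (c v) * gv (GVar.omega v) := by
  let f : (V → ℝ) → GVar V → MvPolynomial (GVar V) ℝ := fun c g => match g with
    | GVar.phi v w k => MvPolynomial.X (GVar.phi v w k)
    | GVar.omega v => MvPolynomial.C (c v) * MvPolynomial.X (GVar.omega v)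
    | GVar.z => MvPolynomial.X GVar.z
  let g : MvPolynomial (GVar V) ℝ →+* MvPolynomial (GVar V) ℝ :=
    (MvPolynomial.aeval (R := ℝ) (f c)).toRingHom
  have hinj : Function.Injective g := by
    apply Function.LeftInverse.injective (g := MvPolynomial.aeval (R := ℝ) (f (fun v => (c v)⁻¹)))
    intro p
    change ((MvPolynomial.aeval (R := ℝ) (f (fun v => (c v)⁻¹))).comp
      (MvPolynomial.aeval (R := ℝ) (f c))) p = AlgHom.id ℝ _ p
    congr 1
    apply MvPolynomial.algHom_ext
    intro i
    rcases i with ⟨v, w, k⟩ | v | _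
    · simp [f]
    · simp only [f, AlgHom.comp_apply, MvPolynomial.aeval_X, map_mul, AlgHom.id_apply,
        MvPolynomial.aeval_C, MvPolynomial.algebraMap_eq]
      rw [← mul_assoc, ← map_mul, mul_inv_cancel₀ (hc v), map_one, one_mul]
    · simp [f]
  have hinj2 : Function.Injective
      ((algebraMap (MvPolynomial (GVar V) ℝ) (GField V)).comp g) :=
    (IsFractionRing.injective (MvPolynomial (GVar V) ℝ) (GField V)).comp hinj
  refine ⟨IsFractionRing.lift hinj2, ?_, ?_, ?_⟩
  · intro v w k
    simp only [gv]
    rw [IsFractionRing.lift_algebraMap]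
    simp [g, f]
  · simp only [gv]
    rw [IsFractionRing.lift_algebraMap]
    simp [g, f]
  · intro v
    simp only [gv, gconst]
    rw [IsFractionRing.lift_algebraMap]
    simp [g, f]

theorem aux_poly {V F : Type*} [Fintype V] [DecidableEq V] [Field F] (s : Set F)
    (hs : s.Infinite) (A B : Matrix V V F) (e : V → F) {r : ℕ} (x y : Fin r → V)
    (h : ∀ c : V → F, (∀ v, c v ∈ s) →
      ((A * diagonal (fun v => c v * e v) * B).submatrix x y).det = 0) (c : V → F) :
    ((A * diagonal (fun v => c v * e v) * B).submatrix x y).det = 0 := by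
  let p : MvPolynomial V F := ((A.map MvPolynomial.C *
    diagonal (fun v => MvPolynomial.X v * MvPolynomial.C (e v)) *
    B.map MvPolynomial.C).submatrix x y).det
  have hp : ∀ c : V → F, MvPolynomial.eval c p =
      ((A * diagonal (fun v => c v * e v) * B).submatrix x y).det := by
    intro c
    simp only [p]
    rw [RingHom.map_det]
    congr 1
    ext i j
    simp [Matrix.mul_apply, Matrix.diagonal_apply]
  have hp0 : p = 0 := by
    apply MvPolynomial.funext_set (fun _ => s) (fun _ => hs)
    intro c hc
    rw [hp, h c (fun v => hc v (Set.mem_univ v)), map_zero]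
  rw [← hp, hp0, map_zero]

/-- in the generic frequency-domain parameterisation of an acyclic process
graph `G = (V, D)`, for equal-sized enumerated subsets `X, Y ⊆ V`, the determinant
`det([S]_{X,Y})` is zero in `𝕂` if and only if every trek system from `X` to `Y` has a sided
intersection, i.e. there is no trek system from `X` to `Y` without sided intersection. -/
theorem det_Smat_submatrix_eq_zero_iff
    {V : Type u} [Fintype V] [DecidableEq V]
    (DO : Finset (V × V)) (hDO : ∀ p ∈ DO, p.1 ≠ p.2)
    (hacyc : ∀ v : V, ¬ Relation.TransGen (fun v w => (v, w) ∈ DO) v v)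
    (Kf : V × V → Finset ℕ)
    (hKedge : ∀ p ∈ DO, (Kf p).Nonempty)
    (hKself : ∀ v : V, 0 ∉ Kf (v, v))
    (σ : GField V ≃+* GField V)
    (hσz : σ (gv (GVar.z : GVar V)) = (gv (GVar.z : GVar V))⁻¹)
    (hσφ : ∀ (v w : V) (k : ℕ), σ (gv (GVar.phi v w k)) = gv (GVar.phi v w k))
    (hσω : ∀ v : V, σ (gv (GVar.omega v)) = gv (GVar.omega v))
    (hσR : ∀ a : ℝ, σ (gconst a) = (gconst a : GField V))
    (r : ℕ) (x y : Fin r → V) (hx : Function.Injective x) (hy : Function.Injective y) :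
    ((Smat DO Kf σ).submatrix x y).det = 0 ↔
      IsEmpty (TrekSystem (fun v w => (v, w) ∈ DO) r x y) := by
  have hHE : ∀ v w, Hmat DO Kf v w ≠ 0 → (v, w) ∈ DO := by
    intro v w h
    by_contra hn
    exact h (if_neg hn)
  have hdetH : (1 - Hmat DO Kf).det ≠ 0 :=
    aux_det_one_sub (fun v w => (v, w) ∈ DO) hacyc _ hHE
  have hdetHT : ((1 - Hmat DO Kf)ᵀ).det ≠ 0 := by rwa [det_transpose]
  have hdetHs : (1 - (Hmat DO Kf).map σ).det ≠ 0 := by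
    apply aux_det_one_sub (fun v w => (v, w) ∈ DO) hacyc
    intro v w h
    apply hHE
    intro h0
    apply h
    rw [Matrix.map_apply, h0, map_zero]
  constructor
  · intro hdet
    refine ⟨fun T => ?_⟩
    -- the tops
    let e : V → GField V := fun v =>
      gv (GVar.omega v) / ((1 - lagPoly Kf v v) * σ (1 - lagPoly Kf v v))
    have hgc : Function.Injective (gconst : ℝ → GField V) :=
      (IsFractionRing.injective (MvPolynomial (GVar V) ℝ) (GField V)).comp
        (MvPolynomial.C_injective (GVar V) ℝ)
    have hinf : (gconst '' ({0}ᶜ : Set ℝ) : Set (GField V)).Infinite :=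
      (Set.finite_singleton (0 : ℝ)).infinite_compl.image hgc.injOn
    have hall := aux_poly _ hinf ((1 - Hmat DO Kf)ᵀ)⁻¹ (1 - (Hmat DO Kf).map σ)⁻¹ e x y (by
      intro c hc
      choose a ha hac using hc
      obtain ⟨ρ, hρφ, hρz, hρω⟩ := aux_scale a ha
      have hρlag : ∀ v w, ρ (lagPoly Kf v w) = lagPoly Kf v w := by
        intro v w
        simp [lagPoly, map_sum, hρφ, hρz]
      have hρσlag : ∀ v w, ρ (σ (lagPoly Kf v w)) = σ (lagPoly Kf v w) := by
        intro v w
        simp [lagPoly, map_sum, hρφ, hρz, hσφ, hσz]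
      have hρH : (Hmat DO Kf).map ρ = Hmat DO Kf := by
        ext v w
        rw [Matrix.map_apply]
        unfold Hmat
        split_ifs
        · simp [hρlag]
        · simp
      have hρσH : ((Hmat DO Kf).map σ).map ρ = (Hmat DO Kf).map σ := by
        ext v w
        rw [Matrix.map_apply, Matrix.map_apply]
        unfold Hmat
        split_ifs
        · simp [hρσlag]
        · simp
      have h1 : (((1 - Hmat DO Kf)ᵀ)⁻¹).map ρ = ((1 - Hmat DO Kf)ᵀ)⁻¹ := by
        rw [aux_map_inv ρ _ hdetHT, Matrix.transpose_map,
          Matrix.map_sub ρ (map_sub ρ), hρH, Matrix.map_one _ (map_zero ρ) (map_one ρ)]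
      have h2 : ((1 - (Hmat DO Kf).map σ)⁻¹).map ρ = (1 - (Hmat DO Kf).map σ)⁻¹ := by
        rw [aux_map_inv ρ _ hdetHs,
          Matrix.map_sub ρ (map_sub ρ), hρσH, Matrix.map_one _ (map_zero ρ) (map_one ρ)]
      have h3 : (SImat Kf σ).map ρ = diagonal (fun v => c v * e v) := by
        unfold SImat
        rw [Matrix.diagonal_map (map_zero ρ)]
        congr 1
        ext v
        simp only [e, map_div₀, map_mul, map_sub, map_one, hρσlag, hρlag, hρω]
        rw [← hac, mul_div_assoc]
      have h4 : (Smat DO Kf σ).map ρ = ((1 - Hmat DO Kf)ᵀ)⁻¹ * diagonal (fun v => c v * e v) *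
          (1 - (Hmat DO Kf).map σ)⁻¹ := by
        unfold Smat
        rw [Matrix.map_mul, Matrix.map_mul, h1, h2, h3]
      have h5 := RingHom.map_det ρ ((Smat DO Kf σ).submatrix x y)
      rw [hdet, map_zero] at h5
      rw [← h4]
      exact h5.symm)
    let t : Fin r → V := fun i => (T.trek i).left.first
    have ht : Function.Injective t := by
      intro i j h
      by_contra hij
      apply T.left_disj i j hij (t i) (List.head_mem _)
      rw [h]
      exact List.head_mem _
    have hL : (((1 - Hmat DO Kf)⁻¹).submatrix t x).det ≠ 0 := by
      have := aux_L_ne DO hDO hacyc Kf hKedge (fun i => (T.trek i).left) T.left_disj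
      simpa only [T.left_last] using this
    have hR : (((1 - Hmat DO Kf)⁻¹).submatrix t y).det ≠ 0 := by
      have := aux_L_ne DO hDO hacyc Kf hKedge (fun i => (T.trek i).right) T.right_disj
      simp only [T.right_last, ← Trek.top_eq] at this
      intro h0
      apply this
      have h2 := Matrix.det_permute' T.perm (((1 - Hmat DO Kf)⁻¹).submatrix t y)
      rw [h0, mul_zero] at h2
      exact h2
    have hRσ : ((1 - (Hmat DO Kf).map σ)⁻¹.submatrix t y).det ≠ 0 := by
      have h1 : ((1 - Hmat DO Kf)⁻¹).map (σ : GField V →+* GField V)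
          = (1 - (Hmat DO Kf).map σ)⁻¹ := by
        rw [aux_map_inv _ _ hdetH, Matrix.map_sub _ (map_sub _),
          Matrix.map_one _ (map_zero _) (map_one _)]
        rfl
      have h2 := RingHom.map_det (σ : GField V →+* GField V)
        (((1 - Hmat DO Kf)⁻¹).submatrix t y)
      rw [← h1]
      intro h0
      apply hR
      have h3 : (σ : GField V →+* GField V) (((1 - Hmat DO Kf)⁻¹).submatrix t y).det = 0 :=
        h2.trans h0
      exact (map_eq_zero _).1 h3
    have he : ∀ v, e v ≠ 0 := by
      intro v
      have h1 := aux_one_sub_lag Kf v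
      refine div_ne_zero ?_ (mul_ne_zero h1 ?_)
      · intro h
        exact MvPolynomial.X_ne_zero (R := ℝ) (GVar.omega v) ((map_eq_zero_iff _
          (IsFractionRing.injective (MvPolynomial (GVar V) ℝ) (GField V))).1 h)
      · exact (map_ne_zero σ).2 h1
    classical
    have hfin := hall (fun v => if v ∈ Set.range t then 1 else 0)
    have hfac : (((1 - Hmat DO Kf)ᵀ)⁻¹ *
        diagonal (fun v => (if v ∈ Set.range t then 1 else 0) * e v) *
        (1 - (Hmat DO Kf).map σ)⁻¹).submatrix x y =
        (((1 - Hmat DO Kf)⁻¹).submatrix t x)ᵀ * diagonal (fun i => e (t i)) *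
          (1 - (Hmat DO Kf).map σ)⁻¹.submatrix t y := by
      rw [← Matrix.transpose_nonsing_inv]
      ext i j
      rw [Matrix.submatrix_apply, Matrix.mul_apply, Matrix.mul_apply]
      simp only [Matrix.mul_diagonal, Matrix.transpose_apply, Matrix.submatrix_apply]
      rw [← Finset.sum_subset (Finset.subset_univ (Finset.univ.image t)),
        Finset.sum_image (fun a _ b _ h => ht h)]
      · apply Finset.sum_congr rfl
        intro k _
        rw [if_pos ⟨k, rfl⟩, one_mul]
      · intro v _ hv
        rw [if_neg (by simpa using hv)]
        simp
    rw [hfac, Matrix.det_mul, Matrix.det_mul, Matrix.det_transpose, Matrix.det_diagonal] at hfin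
    exact mul_ne_zero (mul_ne_zero hL (Finset.prod_ne_zero_iff.2 fun i _ => he _)) hRσ hfin
  · intro hempty
    by_contra hne
    apply not_isEmpty_iff.2 _ hempty
    refine aux_trekSystem _ (1 - Hmat DO Kf)ᵀ (1 - (Hmat DO Kf).map σ) (SImat Kf σ) _ _
      ?_ ?_ ?_ (Matrix.nonsing_inv_mul _ (isUnit_iff_ne_zero.2 hdetHT))
      (Matrix.nonsing_inv_mul _ (isUnit_iff_ne_zero.2 hdetHs)) x y hy hne
    · intro v w hvw h
      apply hHE
      intro h0
      apply h
      rw [Matrix.transpose_apply, Matrix.sub_apply, Matrix.one_apply_ne hvw.symm, h0, sub_zero]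
    · intro v w hvw h
      apply hHE
      intro h0
      apply h
      rw [Matrix.sub_apply, Matrix.one_apply_ne hvw, Matrix.map_apply, h0, map_zero, sub_zero]
    · intro v w hvw
      exact Matrix.diagonal_apply_ne _ hvw
end

section
/- With the generic frequency-domain parameterisation of an acyclic process graph G = (V, D), for all subsets X, Y ⊆ V with |X| = |Y| = r and fixed enumerations of X and Y, det([S]_{X,Y}) = Σ_T sgn(T) · S^{(T)} in 𝕂, where the sum ranges over all trek systems T = (τ_1, …, τ_r) from X to Y without sided intersection, S^{(T)} := ∏_{i=1}^r S^{(τ_i)}, and the trek function of a trek τ with top t is S^{(τ)} := (∏_{(u,u') ∈ Left(τ)} H_{u,u'}) · S^I_{t,t} · σ(∏_{(u,u') ∈ Right(τ)} H_{u,u'}). -/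
open Matrix
open scoped BigOperators

/-- The trek function of a trek `τ` with top `t`: the product of the `H`-entries along its
Left-path, times `S^I_{t,t}`, times `σ` applied to the product of the `H`-entries along its
Right-path. -/
noncomputable def Trek.weight {V : Type*} {E : V → V → Prop} {K : Type*} [CommRing K]
    (H SI : Matrix V V K) (σ : K → K) (τ : Trek E) : K :=
  τ.left.weight H * SI τ.top τ.top * σ (τ.right.weight H)

section LGV
variable {V : Type*} {E : V → V → Prop}

theorem exists_rank [Fintype V] (hacyc : ∀ v : V, ¬ Relation.TransGen E v v) :
    ∃ rk : V → ℕ, ∀ v w, E v w → rk v < rk w := by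
  classical
  refine ⟨fun v => (Finset.univ.filter fun u => Relation.TransGen E u v).card, ?_⟩
  intro v w h
  apply Finset.card_lt_card
  rw [Finset.ssubset_iff_of_subset]
  · exact ⟨v, by simp [Relation.TransGen.single h], by simp [hacyc]⟩
  · intro u hu
    simp only [Finset.mem_filter, Finset.mem_univ, true_and] at hu ⊢
    exact hu.tail h

namespace DiPath

theorem ext' {p q : DiPath E} (h : p.verts = q.verts) : p = q := by
  cases p; cases q; simp_all

/-- prepend an edge -/
def cons (v : V) (p : DiPath E) (h : E v p.first) : DiPath E where
  verts := v :: p.verts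
  ne := by simp
  chain := by
    have hc := p.chain
    obtain ⟨l, hl, hc'⟩ := p
    cases l with
    | nil => exact absurd rfl hl
    | cons a l => exact List.isChain_cons_cons.2 ⟨h, hc⟩

theorem first_cons (v : V) (p : DiPath E) (h : E v p.first) : (cons v p h).first = v := rfl

theorem last_cons (v : V) (p : DiPath E) (h : E v p.first) : (cons v p h).last = p.last := by
  simp [cons, last, List.getLast_cons p.ne]

theorem weight_cons {K : Type*} [CommRing K] (H : Matrix V V K) (v : V) (p : DiPath E)
    (h : E v p.first) : (cons v p h).weight H = H v p.first * p.weight H := by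
  obtain ⟨l, hl, hc'⟩ := p
  cases l with
  | nil => exact absurd rfl hl
  | cons a l => simp [cons, weight, edges, first]

theorem cases' (p : DiPath E) : p.verts = [p.first] ∨ ∃ (q : DiPath E) (h : E p.first q.first),
    p = cons p.first q h := by
  obtain ⟨l, hl, hc⟩ := p
  match l, hl, hc with
  | [a], _, _ => left; rfl
  | a :: b :: l, _, hc =>
    right
    have := List.isChain_cons_cons.1 hc
    exact ⟨⟨b :: l, by simp, this.2⟩, this.1, rfl⟩

theorem first_mem (p : DiPath E) : p.first ∈ p.verts := List.head_mem _
theorem last_mem (p : DiPath E) : p.last ∈ p.verts := List.getLast_mem _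

theorem pairwise_rk {rk : V → ℕ} (hrk : ∀ v w, E v w → rk v < rk w) (p : DiPath E) :
    p.verts.Pairwise (fun a b => rk a < rk b) := by
  have hc : List.IsChain E p.verts := p.chain
  have h2 : List.IsChain (fun a b => rk a < rk b) p.verts := hc.imp (fun a b h => hrk a b h)
  have : IsTrans V (fun a b => rk a < rk b) := ⟨fun a b c h1 h2 => lt_trans h1 h2⟩
  exact h2.pairwise

theorem mem_rk {rk : V → ℕ} (hrk : ∀ v w, E v w → rk v < rk w) (p : DiPath E) {q : V}
    (hq : q ∈ p.verts) : q = p.first ∨ rk p.first < rk q := by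
  have := pairwise_rk hrk p
  obtain ⟨l, hl, hc⟩ := p
  cases l with
  | nil => exact absurd rfl hl
  | cons a l =>
    simp only [List.pairwise_cons, List.mem_cons] at this hq
    rcases hq with rfl | hq
    · left; rfl
    · right; exact this.1 q hq

theorem verts_eq_of_closed {rk : V → ℕ} (hrk : ∀ v w, E v w → rk v < rk w) (p : DiPath E)
    (h : p.first = p.last) : p.verts = [p.first] := by
  rcases cases' p with h1 | ⟨q, hE, h1⟩
  · exact h1
  · exfalso
    have h2 := mem_rk hrk q (last_mem q)
    have h3 : p.last = q.last := by rw [h1, last_cons]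
    have h4 := hrk _ _ hE
    rw [h, h3] at h4
    rcases h2 with h2 | h2
    · rw [h2] at h4; exact lt_irrefl _ h4
    · omega

theorem finite [Fintype V] {rk : V → ℕ} (hrk : ∀ v w, E v w → rk v < rk w) :
    Finite (DiPath E) := by
  classical
  have hn : ∀ p : DiPath E, p.verts.Nodup := fun p =>
    (pairwise_rk hrk p).imp (fun {a b} h => by rintro rfl; exact lt_irrefl _ h)
  exact Finite.of_injective (fun p : DiPath E => (⟨p.verts, hn p⟩ : {l : List V // l.Nodup}))
    (fun p q h => ext' (by simpa using h))

theorem weight_map {K : Type*} [CommRing K] (H : Matrix V V K) (σ : K →+* K) (p : DiPath E) :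
    p.weight (H.map σ) = σ (p.weight H) := by
  simp [weight, map_list_prod, Function.comp_def]

/-- trivial path -/
def triv (v : V) : DiPath E := ⟨[v], by simp, List.isChain_singleton v⟩

end DiPath

/-- straight nonintersecting path systems -/
def IsSys {r : ℕ} (p : Fin r → DiPath E) (f g : Fin r → V) : Prop :=
  (∀ i, (p i).first = f i) ∧ (∀ i, (p i).last = g i) ∧
    ∀ i j, i ≠ j → ∀ v ∈ (p i).verts, v ∉ (p j).verts

theorem IsSys.injective {r : ℕ} {p : Fin r → DiPath E} {f g : Fin r → V} (h : IsSys p f g) :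
    Function.Injective f := by
  intro i j hij
  by_contra hne
  refine h.2.2 i j hne (f i) ?_ ?_
  · rw [← h.1]; exact DiPath.first_mem _
  · rw [hij, ← h.1]; exact DiPath.first_mem _

open Classical in
/-- weighted count of straight nonintersecting path systems -/
noncomputable def NS [Fintype (DiPath E)] {K : Type*} [CommRing K] (H : Matrix V V K) {r : ℕ}
    (f g : Fin r → V) : K :=
  ∑ p ∈ (Finset.univ : Finset (Fin r → DiPath E)).filter (fun p => IsSys p f g),
    ∏ i, (p i).weight H

open Classical in
theorem NS_of_not_injective [Fintype (DiPath E)] {K : Type*} [CommRing K] (H : Matrix V V K)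
    {r : ℕ} {f : Fin r → V} (hf : ¬ Function.Injective f) (g : Fin r → V) :
    NS (E := E) H f g = 0 := by
  unfold NS
  rw [Finset.filter_false_of_mem]
  · simp
  · intro p _ h; exact hf h.injective

open Classical in
theorem NS_rec [Fintype V] [Fintype (DiPath E)] {K : Type*} [CommRing K] (H : Matrix V V K)
    (hH : ∀ v w, ¬ E v w → H v w = 0)
    {rk : V → ℕ} (hrk : ∀ v w, E v w → rk v < rk w) {r : ℕ} (f g : Fin r → V)
    (hf : Function.Injective f) (i₀ : Fin r) (hg : ∀ k, g k ≠ f i₀)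
    (hmin : ∀ j, (∀ k, g k ≠ f j) → rk (f i₀) ≤ rk (f j)) :
    NS (E := E) H f g = ∑ w, H (f i₀) w * NS (E := E) H (Function.update f i₀ w) g := by
  have h1 : ∑ w, H (f i₀) w * NS (E := E) H (Function.update f i₀ w) g =
      ∑ w ∈ Finset.univ.filter (fun w => E (f i₀) w),
        H (f i₀) w * NS (E := E) H (Function.update f i₀ w) g := by
    symm
    apply Finset.sum_subset (Finset.subset_univ _)
    intro w _ hw
    rw [hH _ _ (by simpa using hw), zero_mul]
  rw [h1]
  unfold NS
  simp_rw [Finset.mul_sum]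
  rw [Finset.sum_sigma']
  symm
  have key : ∀ a : (Σ _ : V, Fin r → DiPath E),
      a ∈ ((Finset.univ.filter (fun w => E (f i₀) w)).sigma fun w =>
        (Finset.univ : Finset (Fin r → DiPath E)).filter
          (fun p => IsSys p (Function.update f i₀ w) g)) →
      (a.2 i₀).first = a.1 ∧ E (f i₀) (a.2 i₀).first := by
    rintro ⟨w, p⟩ h
    simp only [Finset.mem_sigma, Finset.mem_filter, Finset.mem_univ, true_and] at h
    have := h.2.1 i₀
    simp only [Function.update_self] at this
    refine ⟨this, ?_⟩
    simp only [this]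
    exact h.1
  refine Finset.sum_bij (fun a ha => Function.update a.2 i₀ (DiPath.cons (f i₀) (a.2 i₀) (key a ha).2))
    ?_ ?_ ?_ ?_
  · rintro ⟨w, p⟩ ha
    have hk := key _ ha
    simp only [Finset.mem_sigma, Finset.mem_filter, Finset.mem_univ, true_and] at ha ⊢
    obtain ⟨hE, hp1, hp2, hp3⟩ := ha
    have hnv : ∀ j, j ≠ i₀ → f i₀ ∉ (p j).verts := by
      intro j hj hmem
      have hfj : (p j).first = f j := by rw [hp1, Function.update_of_ne hj]
      by_cases hr : ∀ k, g k ≠ f j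
      · have := hmin j hr
        rcases DiPath.mem_rk hrk _ hmem with h | h
        · rw [hfj] at h; exact hj (hf h.symm)
        · rw [hfj] at h; omega
      · push Not at hr
        obtain ⟨k, hk'⟩ := hr
        have hkj : k = j := by
          by_contra hne
          refine hp3 k j hne (g k) ?_ ?_
          · rw [← hp2]; exact DiPath.last_mem _
          · rw [hk', ← hfj]; exact DiPath.first_mem _
        subst hkj
        have := DiPath.verts_eq_of_closed hrk (p k) (by rw [hfj, hp2, hk'])
        rw [this, hfj] at hmem
        simp only [List.mem_singleton] at hmem
        exact hj (hf hmem.symm)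
    refine ⟨?_, ?_, ?_⟩
    · intro i
      by_cases hi : i = i₀
      · subst hi; simp [DiPath.first_cons]
      · simp [Function.update_of_ne hi, hp1]
    · intro i
      by_cases hi : i = i₀
      · subst hi; simp [DiPath.last_cons, hp2]
      · simp [Function.update_of_ne hi, hp2]
    · intro i j hij v hv hv'
      by_cases hi : i = i₀
      · subst hi
        rw [Function.update_of_ne (Ne.symm hij)] at hv'
        simp only [Function.update_self, DiPath.cons, List.mem_cons] at hv
        rcases hv with rfl | hv
        · exact hnv j (Ne.symm hij) hv'
        · exact hp3 _ _ hij v hv hv'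
      · rw [Function.update_of_ne hi] at hv
        by_cases hj : j = i₀
        · subst hj
          simp only [Function.update_self, DiPath.cons, List.mem_cons] at hv'
          rcases hv' with rfl | hv'
          · exact hnv i hi hv
          · exact hp3 _ _ hij v hv hv'
        · rw [Function.update_of_ne hj] at hv'
          exact hp3 _ _ hij v hv hv'
  · rintro ⟨w, p⟩ ha ⟨w', p'⟩ ha' heq
    have hk := key _ ha
    have hk' := key _ ha'
    simp only at heq hk hk'
    have hpp : p = p' := by
      funext i
      by_cases hi : i = i₀
      · subst hi
        have := congrArg DiPath.verts (congrFun heq i)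
        simp only [Function.update_self, DiPath.cons, List.cons.injEq, true_and] at this
        exact DiPath.ext' this
      · have := congrFun heq i
        simpa [Function.update_of_ne hi] using this
    subst hpp
    have : w = w' := hk.1.symm.trans hk'.1
    subst this
    rfl
  · intro p hp
    simp only [Finset.mem_filter, Finset.mem_univ, true_and] at hp
    obtain ⟨hp1, hp2, hp3⟩ := hp
    rcases DiPath.cases' (p i₀) with h | ⟨q, hE, hq⟩
    · exfalso
      have : (p i₀).last ∈ (p i₀).verts := DiPath.last_mem _
      rw [h, hp2, hp1] at this
      exact hg i₀ (by simpa using this)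
    · have hqv : ∀ v ∈ q.verts, v ∈ (p i₀).verts := by
        intro v hv; rw [hq]; exact List.mem_cons_of_mem _ hv
      have hqE : E (f i₀) q.first := by rw [← hp1]; exact hE
      refine ⟨⟨q.first, Function.update p i₀ q⟩, ?_, ?_⟩
      · simp only [Finset.mem_sigma, Finset.mem_filter, Finset.mem_univ, true_and]
        refine ⟨hqE, ?_, ?_, ?_⟩
        · intro i
          by_cases hi : i = i₀
          · subst hi; simp
          · simp [Function.update_of_ne hi, hp1]
        · intro i
          by_cases hi : i = i₀
          · subst hi
            rw [Function.update_self, ← hp2, hq, DiPath.last_cons]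
          · simp [Function.update_of_ne hi, hp2]
        · have hsub : ∀ i, ∀ v ∈ (Function.update p i₀ q i).verts, v ∈ (p i).verts := by
            intro i v hv
            by_cases hi : i = i₀
            · subst hi; rw [Function.update_self] at hv; exact hqv v hv
            · rwa [Function.update_of_ne hi] at hv
          intro i j hij v hv hv'
          exact hp3 i j hij v (hsub i v hv) (hsub j v hv')
      · funext i
        by_cases hi : i = i₀
        · subst hi
          apply DiPath.ext'
          have := congrArg DiPath.verts hq
          simp only [Function.update_self, this]
          simp only [DiPath.cons, hp1]
        · simp [Function.update_of_ne hi]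
  · rintro ⟨w, p⟩ ha
    have hk := key _ ha
    simp only at hk
    simp only
    rw [← Finset.mul_prod_erase _ _ (Finset.mem_univ i₀),
      ← Finset.mul_prod_erase _ (fun i => (Function.update p i₀ _ i).weight H) (Finset.mem_univ i₀)]
    rw [Function.update_self, DiPath.weight_cons, mul_assoc]
    congr 1
    · rw [hk.1]
    congr 1
    apply Finset.prod_congr rfl
    intro i hi
    rw [Function.update_of_ne (Finset.ne_of_mem_erase hi)]

theorem tri_det {ι : Type*} [Fintype ι] [DecidableEq ι] {K : Type*} [CommRing K]
    (M : Matrix ι ι K) (rk : ι → ℕ) (h : ∀ i j, M i j ≠ 0 → i = j ∨ rk i < rk j)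
    (hd : ∀ i, M i i = 1) : M.det = 1 := by
  rw [Matrix.det_apply, Finset.sum_eq_single (1 : Equiv.Perm ι)]
  · simp [hd]
  · intro π _ hπ
    by_contra hne
    have hne' : ∏ i, M (π i) i ≠ 0 := by
      intro h0; rw [h0] at hne; simp at hne
    have hi : ∀ i, M (π i) i ≠ 0 := fun i h0 => hne' (Finset.prod_eq_zero (Finset.mem_univ i) h0)
    have hle : ∀ i ∈ Finset.univ, rk (π i) ≤ rk i := by
      intro i _
      rcases h _ _ (hi i) with h1 | h1
      · rw [h1]
      · exact h1.le
    have hs : ∑ i, rk (π i) = ∑ i, rk i := Equiv.sum_comp π rk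
    have heq := (Finset.sum_eq_sum_iff_of_le hle).1 hs
    apply hπ
    ext i
    rcases h _ _ (hi i) with h1 | h1
    · exact h1
    · have := heq i (Finset.mem_univ i); omega
  · simp

theorem A_tri [Fintype V] [DecidableEq V] {K : Type*} [CommRing K] (H A : Matrix V V K)
    (hH : ∀ v w, ¬ E v w → H v w = 0) (hA : A = 1 + H * A)
    {rk : V → ℕ} (hrk : ∀ v w, E v w → rk v < rk w) :
    (∀ v w, A v w ≠ 0 → v = w ∨ rk v < rk w) ∧ ∀ v, A v v = 1 := by
  have hAe : ∀ v w, A v w = (1 : Matrix V V K) v w + ∑ u, H v u * A u w := by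
    intro v w
    conv_lhs => rw [hA]
    rw [Matrix.add_apply, Matrix.mul_apply]
  obtain ⟨M, hM⟩ : ∃ M, ∀ v, rk v ≤ M :=
    ⟨∑ v, rk v, fun v => Finset.single_le_sum (fun _ _ => Nat.zero_le _) (Finset.mem_univ v)⟩
  have h1 : ∀ n v w, M - rk v ≤ n → A v w ≠ 0 → v = w ∨ rk v < rk w := by
    intro n
    induction n with
    | zero =>
      intro v w hn hne
      by_cases hvw : v = w
      · exact Or.inl hvw
      rw [hAe, Matrix.one_apply_ne hvw, zero_add] at hne
      obtain ⟨u, _, hu⟩ := Finset.exists_ne_zero_of_sum_ne_zero hne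
      have hE : E v u := by
        by_contra hE; rw [hH _ _ hE, zero_mul] at hu; exact hu rfl
      have := hrk _ _ hE
      have := hM u
      omega
    | succ n ih =>
      intro v w hn hne
      by_cases hvw : v = w
      · exact Or.inl hvw
      rw [hAe, Matrix.one_apply_ne hvw, zero_add] at hne
      obtain ⟨u, _, hu⟩ := Finset.exists_ne_zero_of_sum_ne_zero hne
      have hE : E v u := by
        by_contra hE; rw [hH _ _ hE, zero_mul] at hu; exact hu rfl
      have h1 := hrk _ _ hE
      have := hM u
      have hAu : A u w ≠ 0 := by
        intro h0; rw [h0, mul_zero] at hu; exact hu rfl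
      rcases ih u w (by omega) hAu with h | h
      · rw [← h]; exact Or.inr h1
      · right; omega
  have h2 : ∀ v w, A v w ≠ 0 → v = w ∨ rk v < rk w := fun v w => h1 _ v w le_rfl
  refine ⟨h2, fun v => ?_⟩
  rw [hAe, Matrix.one_apply_eq, Finset.sum_eq_zero, add_zero]
  intro u _
  by_cases hE : E v u
  · have h3 := hrk _ _ hE
    by_cases hAu : A u v = 0
    · rw [hAu, mul_zero]
    · rcases h2 _ _ hAu with h | h
      · rw [h] at h3; exact absurd h3 (lt_irrefl _)
      · omega
  · rw [hH _ _ hE, zero_mul]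

open Classical in
theorem NS_terminal [Fintype (DiPath E)] {K : Type*} [CommRing K] (H : Matrix V V K)
    {rk : V → ℕ} (hrk : ∀ v w, E v w → rk v < rk w) {r : ℕ} (x : Fin r → V)
    (hx : Function.Injective x) (π ρ : Equiv.Perm (Fin r)) :
    NS (E := E) H (x ∘ π) (x ∘ ρ) = if ρ = π then 1 else 0 := by
  unfold NS
  split_ifs with h
  · subst h
    rw [Finset.sum_eq_single (fun i => DiPath.triv (x (ρ i)))]
    · apply Finset.prod_eq_one
      intro i _
      simp [DiPath.triv, DiPath.weight, DiPath.edges]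
    · intro p hp hne
      exfalso
      simp only [Finset.mem_filter, Finset.mem_univ, true_and] at hp
      apply hne
      funext i
      apply DiPath.ext'
      rw [DiPath.verts_eq_of_closed hrk (p i) (by rw [hp.1, hp.2.1]), hp.1]
      rfl
    · intro hn
      exfalso
      apply hn
      simp only [Finset.mem_filter, Finset.mem_univ, true_and]
      refine ⟨fun i => rfl, fun i => rfl, ?_⟩
      intro i j hij v hv hv'
      simp only [DiPath.triv, List.mem_singleton] at hv hv'
      exact hij (ρ.injective (hx (hv.symm.trans hv')))
  · rw [Finset.filter_false_of_mem]
    · simp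
    · intro p _ hp
      apply h
      ext i
      congr 1
      obtain ⟨k, hk⟩ := ρ.surjective (π i)
      have : k = i := by
        by_contra hne
        refine hp.2.2 k i hne (x (π i)) ?_ ?_
        · rw [← hk]; have := (p k).last_mem; rwa [hp.2.1] at this
        · have := (p i).first_mem; rwa [hp.1] at this
      rw [← this, hk, this]

theorem LGV [Fintype V] [DecidableEq V] [Fintype (DiPath E)] {K : Type*} [CommRing K]
    (H A : Matrix V V K)
    (hH : ∀ v w, ¬ E v w → H v w = 0) (hA : A = 1 + H * A)
    {rk : V → ℕ} (hrk : ∀ v w, E v w → rk v < rk w) {r : ℕ} (x : Fin r → V)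
    (hx : Function.Injective x) (f : Fin r → V) :
    (A.submatrix f x).det =
      ∑ π : Equiv.Perm (Fin r), ((Equiv.Perm.sign π : ℤ) : K) * NS (E := E) H f (x ∘ π) := by
  classical
  obtain ⟨M, hM⟩ : ∃ M, ∀ v, rk v ≤ M :=
    ⟨∑ v, rk v, fun v => Finset.single_le_sum (fun _ _ => Nat.zero_le _) (Finset.mem_univ v)⟩
  obtain ⟨hA1, hA2⟩ := A_tri H A hH hA hrk
  induction hn : ∑ i, (M - rk (f i)) using Nat.strong_induction_on generalizing f with
  | _ n ih =>
  by_cases hf : Function.Injective f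
  swap
  · have hz : ∀ π : Equiv.Perm (Fin r), NS (E := E) H f (x ∘ π) = 0 :=
      fun π => NS_of_not_injective H hf _
    simp only [hz, mul_zero, Finset.sum_const_zero]
    rw [Function.not_injective_iff] at hf
    obtain ⟨i, j, hij, hne⟩ := hf
    apply Matrix.det_zero_of_row_eq hne
    funext k
    simp [hij]
  by_cases hT : ∀ i, ∃ k, x k = f i
  · choose p hp using hT
    have hpi : Function.Injective p := by
      intro i j hij
      apply hf
      rw [← hp, ← hp, hij]
    let π : Equiv.Perm (Fin r) := Equiv.ofBijective p (Finite.injective_iff_bijective.1 hpi)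
    have hfπ : f = x ∘ π := by funext i; exact (hp i).symm
    rw [hfπ]
    simp only [NS_terminal H hrk x hx]
    have h1 : A.submatrix (x ∘ π) x = (A.submatrix x x).submatrix π id := rfl
    rw [h1, Matrix.det_permute, tri_det (A.submatrix x x) (rk ∘ x)]
    · simp
    · intro i j hij
      rcases hA1 _ _ hij with h | h
      · exact Or.inl (hx h)
      · exact Or.inr h
    · intro i; exact hA2 _
  · push Not at hT
    obtain ⟨i₀, hi₀, hmin⟩ := Finset.exists_min_image
      (Finset.univ.filter fun i => ∀ k, x k ≠ f i) (fun i => rk (f i))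
      (by obtain ⟨i, hi⟩ := hT; exact ⟨i, by simpa using hi⟩)
    simp only [Finset.mem_filter, Finset.mem_univ, true_and] at hi₀ hmin
    have hN : ∀ π : Equiv.Perm (Fin r), NS (E := E) H f (x ∘ π) =
        ∑ w, H (f i₀) w * NS (E := E) H (Function.update f i₀ w) (x ∘ π) := by
      intro π
      apply NS_rec H hH hrk f _ hf i₀
      · intro k; exact hi₀ _
      · intro j hj
        apply hmin
        intro k
        have := hj (π.symm k)
        simpa using this
    have hD : (A.submatrix f x).det =
        ∑ w, H (f i₀) w * (A.submatrix (Function.update f i₀ w) x).det := by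
      have h1 : A.submatrix f x = Matrix.updateRow (A.submatrix f x) i₀
          (∑ w, H (f i₀) w • (fun j => A w (x j))) := by
        ext i j
        by_cases hi : i = i₀
        · subst hi
          rw [Matrix.updateRow_self, Finset.sum_apply]
          simp only [Matrix.submatrix_apply, Pi.smul_apply, smul_eq_mul]
          conv_lhs => rw [hA]
          rw [Matrix.add_apply, Matrix.mul_apply, Matrix.one_apply_ne (hi₀ j).symm, zero_add]
        · rw [Matrix.updateRow_ne hi]
      rw [h1]
      refine (Matrix.detRowAlternating.map_update_sum _ _ _ _).trans ?_
      apply Finset.sum_congr rfl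
      intro w _
      refine (Matrix.detRowAlternating.map_update_smul _ _ _ _).trans ?_
      rw [smul_eq_mul]
      congr 1
      change Matrix.det _ = Matrix.det _
      congr 1
      funext i j
      by_cases hi : i = i₀
      · subst hi
        refine (congrFun (Function.update_self (β := fun _ => Fin r → K) i _ _) j).trans ?_
        simp
      · refine (congrFun (Function.update_of_ne (β := fun _ => Fin r → K) hi _ _) j).trans ?_
        simp [Function.update_of_ne hi]
    rw [hD]
    simp only [hN, Finset.mul_sum]
    rw [Finset.sum_comm]
    apply Finset.sum_congr rfl
    intro w _
    by_cases hE : E (f i₀) w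
    · rw [ih _ _ (Function.update f i₀ w) rfl, Finset.mul_sum]
      · apply Finset.sum_congr rfl
        intro π _
        ring
      · rw [← hn]
        apply Finset.sum_lt_sum
        · intro i _
          by_cases hi : i = i₀
          · subst hi
            rw [Function.update_self]
            have := hrk _ _ hE
            omega
          · rw [Function.update_of_ne hi]
        · refine ⟨i₀, Finset.mem_univ _, ?_⟩
          rw [Function.update_self]
          have := hrk _ _ hE
          have := hM w
          omega
    · simp [hH _ _ hE]

theorem asym_sum [Fintype V] {K : Type*} [CommRing K] {r : ℕ}
    (P G : (Fin r → V) → K) (π : Equiv.Perm (Fin r))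
    (hG : ∀ f, G (f ∘ π) = ((Equiv.Perm.sign π : ℤ) : K) * G f) :
    ∑ f, ((Equiv.Perm.sign π : ℤ) : K) * P (f ∘ π) * G f = ∑ f, P f * G f := by
  rw [← Equiv.sum_comp (Equiv.arrowCongr π.symm (Equiv.refl V)) (fun f => P f * G f)]
  apply Finset.sum_congr rfl
  intro f _
  have : (Equiv.arrowCongr π.symm (Equiv.refl V)) f = f ∘ π := by
    funext i; simp [Equiv.arrowCongr]
  rw [this, hG]
  ring

open Classical in
theorem NS_comp [Fintype (DiPath E)] {K : Type*} [CommRing K] (H : Matrix V V K)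
    {r : ℕ} (f g : Fin r → V) (π : Equiv.Perm (Fin r)) :
    NS (E := E) H (f ∘ π) (g ∘ π) = NS (E := E) H f g := by
  unfold NS
  symm
  apply Finset.sum_equiv (Equiv.arrowCongr π.symm (Equiv.refl (DiPath E)))
  · intro p
    simp only [Finset.mem_filter, Finset.mem_univ, true_and]
    have : (Equiv.arrowCongr π.symm (Equiv.refl _)) p = p ∘ π := by
      funext i; simp [Equiv.arrowCongr]
    rw [this]
    constructor
    · rintro ⟨h1, h2, h3⟩
      exact ⟨fun i => h1 _, fun i => h2 _, fun i j hij => h3 _ _ (fun h => hij (π.injective h))⟩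
    · rintro ⟨h1, h2, h3⟩
      refine ⟨fun i => ?_, fun i => ?_, fun i j hij => ?_⟩
      · simpa using h1 (π.symm i)
      · simpa using h2 (π.symm i)
      · simpa using h3 (π.symm i) (π.symm j) (fun h => hij (π.symm.injective h))
  · intro p _
    have : (Equiv.arrowCongr π.symm (Equiv.refl _)) p = p ∘ π := by
      funext i; simp [Equiv.arrowCongr]
    rw [this]
    exact (Equiv.prod_comp π (fun i => (p i).weight H)).symm

theorem det_core [Fintype V] [DecidableEq V] [Fintype (DiPath E)] {K : Type*} [Field K] [CharZero K]
    (H A H' B : Matrix V V K) (D : V → K)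
    (hH : ∀ v w, ¬ E v w → H v w = 0) (hA : A = 1 + H * A)
    (hH' : ∀ v w, ¬ E v w → H' v w = 0) (hB : B = 1 + H' * B)
    {rk : V → ℕ} (hrk : ∀ v w, E v w → rk v < rk w) {r : ℕ} (x y : Fin r → V)
    (hx : Function.Injective x) (hy : Function.Injective y) :
    ((Aᵀ * Matrix.diagonal D * B).submatrix x y).det =
      ∑ f : Fin r → V, ∑ π : Equiv.Perm (Fin r),
        NS (E := E) H f x * ((∏ i, D (f i)) *
          (((Equiv.Perm.sign π : ℤ) : K) * NS (E := E) H' f (y ∘ π))) := by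
  have h1 : ((Aᵀ * Matrix.diagonal D * B).submatrix x y).det =
      ∑ f : Fin r → V, (∏ i, A (f i) (x i)) * ((∏ i, D (f i)) * (B.submatrix f y).det) := by
    have h2 : (Aᵀ * Matrix.diagonal D * B).submatrix x y =
        fun i => ∑ v, (A v (x i) * D v) • (fun j => B v (y j)) := by
      funext i j
      rw [Matrix.submatrix_apply, Matrix.mul_apply, Finset.sum_apply]
      apply Finset.sum_congr rfl
      intro v _
      rw [Matrix.mul_diagonal]
      simp
    rw [h2]
    refine (Matrix.detRowAlternating.toMultilinearMap.map_sum _).trans ?_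
    apply Finset.sum_congr rfl
    intro f _
    refine (Matrix.detRowAlternating.toMultilinearMap.map_smul_univ _ _).trans ?_
    rw [smul_eq_mul, Finset.prod_mul_distrib, mul_assoc]
    rfl
  rw [h1]
  set G : (Fin r → V) → K := fun f => (∏ i, D (f i)) * (B.submatrix f y).det with hGdef
  have hG : ∀ (π : Equiv.Perm (Fin r)) f, G (f ∘ π) = ((Equiv.Perm.sign π : ℤ) : K) * G f := by
    intro π f
    simp only [hGdef]
    have e1 : ∏ i, D ((f ∘ π) i) = ∏ i, D (f i) := Equiv.prod_comp π (fun i => D (f i))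
    have e2 : B.submatrix (f ∘ π) y = (B.submatrix f y).submatrix π id := rfl
    rw [e1, e2, Matrix.det_permute]
    ring
  have h3 : ∑ f : Fin r → V, (∏ i, A (f i) (x i)) * G f = ∑ f, NS (E := E) H f x * G f := by
    have hc : (Fintype.card (Equiv.Perm (Fin r)) : K) ≠ 0 := by
      rw [Nat.cast_ne_zero]; exact Fintype.card_ne_zero
    apply mul_left_cancel₀ hc
    have e1 : ∑ π : Equiv.Perm (Fin r), ∑ f : Fin r → V,
        ((Equiv.Perm.sign π : ℤ) : K) * (∏ i, A ((f ∘ π) i) (x i)) * G f =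
        (Fintype.card (Equiv.Perm (Fin r)) : K) * ∑ f : Fin r → V, (∏ i, A (f i) (x i)) * G f := by
      rw [Finset.sum_congr rfl (fun π _ => asym_sum (fun f => ∏ i, A (f i) (x i)) G π (hG π))]
      simp
    have e2 : ∑ π : Equiv.Perm (Fin r), ∑ f : Fin r → V,
        ((Equiv.Perm.sign π : ℤ) : K) * NS (E := E) H (f ∘ π) x * G f =
        (Fintype.card (Equiv.Perm (Fin r)) : K) * ∑ f, NS (E := E) H f x * G f := by
      rw [Finset.sum_congr rfl (fun π _ => asym_sum (fun f => NS (E := E) H f x) G π (hG π))]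
      simp
    rw [← e1, ← e2, Finset.sum_comm, Finset.sum_comm (s := Finset.univ (α := Equiv.Perm (Fin r)))]
    apply Finset.sum_congr rfl
    intro f _
    rw [← Finset.sum_mul, ← Finset.sum_mul]
    congr 1
    have e3 := LGV H A hH hA hrk x hx f
    rw [Matrix.det_apply'] at e3
    refine Eq.trans e3 ?_
    rw [← Equiv.sum_comp (Equiv.inv (Equiv.Perm (Fin r)))]
    apply Finset.sum_congr rfl
    intro π _
    rw [← NS_comp H f _ π]
    have : (x ∘ ⇑((Equiv.inv (Equiv.Perm (Fin r))) π)) ∘ ⇑π = x := by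
      funext i; simp
    rw [this]
    simp
  rw [h3]
  apply Finset.sum_congr rfl
  intro f _
  simp only [hGdef]
  rw [LGV H' B hH' hB hrk y hy f, Finset.mul_sum, Finset.mul_sum]

/-- encode trek systems -/
def trekEquiv {r : ℕ} (x y : Fin r → V) : TrekSystem E r x y ≃
    {t : (Fin r → V) × Equiv.Perm (Fin r) × (Fin r → DiPath E) × (Fin r → DiPath E) //
      IsSys t.2.2.1 t.1 x ∧ IsSys t.2.2.2 t.1 (y ∘ t.2.1)} where
  toFun T := ⟨(fun i => (T.trek i).top, T.perm, fun i => (T.trek i).left,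
    fun i => (T.trek i).right), ⟨fun i => rfl, T.left_last, T.left_disj⟩,
      ⟨fun i => (T.trek i).top_eq.symm, T.right_last, T.right_disj⟩⟩
  invFun t :=
    { trek := fun i => ⟨t.1.2.2.1 i, t.1.2.2.2 i, by rw [t.2.1.1, t.2.2.1]⟩
      perm := t.1.2.1
      left_last := t.2.1.2.1
      right_last := t.2.2.2.1
      left_disj := t.2.1.2.2
      right_disj := t.2.2.2.2 }
  left_inv T := rfl
  right_inv t := by
    obtain ⟨⟨f, π, p, q⟩, h1, h2⟩ := t
    have : (fun i => (p i).first) = f := funext h1.1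
    subst this
    rfl

theorem finsum_trek [Fintype V] [Fintype (DiPath E)] {K : Type*} [CommRing K]
    (H SI : Matrix V V K) (σ : K →+* K) {r : ℕ} (x y : Fin r → V) :
    ∑ᶠ T : TrekSystem E r x y, ((Equiv.Perm.sign T.perm : ℤ) : K) *
          ∏ i, (T.trek i).weight H SI σ =
      ∑ f : Fin r → V, ∑ π : Equiv.Perm (Fin r),
        NS (E := E) H f x * ((∏ i, SI (f i) (f i)) *
          (((Equiv.Perm.sign π : ℤ) : K) * NS (E := E) (H.map σ) f (y ∘ π))) := by
  classical
  let F : (Fin r → V) × Equiv.Perm (Fin r) × (Fin r → DiPath E) × (Fin r → DiPath E) → K :=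
    fun t => (∏ i, (t.2.2.1 i).weight H) * ((∏ i, SI (t.1 i) (t.1 i)) *
      (((Equiv.Perm.sign t.2.1 : ℤ) : K) * ∏ i, (t.2.2.2 i).weight (H.map σ)))
  have h1 : ∑ᶠ T : TrekSystem E r x y, ((Equiv.Perm.sign T.perm : ℤ) : K) *
          ∏ i, (T.trek i).weight H SI σ =
      ∑ᶠ T : TrekSystem E r x y, F (trekEquiv x y T).1 := by
    apply finsum_congr
    intro T
    simp only [F, trekEquiv, Equiv.coe_fn_mk, Trek.weight, Finset.prod_mul_distrib,
      DiPath.weight_map]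
    ring
  rw [h1, finsum_comp_equiv (trekEquiv x y) (f := fun t => F t.1), finsum_eq_sum_of_fintype,
    ← Finset.sum_subtype (Finset.univ.filter fun t :
      (Fin r → V) × Equiv.Perm (Fin r) × (Fin r → DiPath E) × (Fin r → DiPath E) =>
      IsSys t.2.2.1 t.1 x ∧ IsSys t.2.2.2 t.1 (y ∘ t.2.1)) (by simp) F]
  rw [Finset.sum_filter, Fintype.sum_prod_type]
  apply Finset.sum_congr rfl
  intro f _
  rw [Fintype.sum_prod_type]
  apply Finset.sum_congr rfl
  intro π _
  rw [Fintype.sum_prod_type]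
  unfold NS
  rw [Finset.sum_filter, Finset.sum_mul]
  apply Finset.sum_congr rfl
  intro p _
  rw [Finset.sum_filter, Finset.mul_sum, Finset.mul_sum, Finset.mul_sum]
  apply Finset.sum_congr rfl
  intro q _
  by_cases hp : IsSys p f x <;> by_cases hq : IsSys q f (y ∘ π) <;> simp [hp, hq, F]

theorem inv_eq [Fintype V] [DecidableEq V] {K : Type*} [CommRing K] (H : Matrix V V K)
    (hH : ∀ v w, ¬ E v w → H v w = 0) {rk : V → ℕ} (hrk : ∀ v w, E v w → rk v < rk w) :
    (1 - H)⁻¹ = 1 + H * (1 - H)⁻¹ := by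
  have hd : (1 - H).det = 1 := by
    apply tri_det _ rk
    · intro v w hne
      by_cases hvw : v = w
      · exact Or.inl hvw
      · right
        apply hrk
        by_contra hE
        apply hne
        rw [Matrix.sub_apply, Matrix.one_apply_ne hvw, hH _ _ hE, sub_zero]
    · intro v
      rw [Matrix.sub_apply, Matrix.one_apply_eq, hH v v (fun h => lt_irrefl _ (hrk _ _ h)), sub_zero]
  have h := Matrix.mul_nonsing_inv (1 - H) (by rw [hd]; exact isUnit_one)
  rw [sub_mul, one_mul] at h
  exact sub_eq_iff_eq_add.1 h

end LGV

/-- in the generic frequency-domain parameterisation of an acyclic process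
graph `G = (V, D)`, for equal-sized enumerated subsets `X, Y ⊆ V`,
`det([S]_{X,Y}) = Σ_T sgn(T) · S^{(T)}` in `𝕂`, the sum ranging over all trek systems `T`
from `X` to `Y` without sided intersection, where `S^{(T)}` is the product of the trek
functions of the treks of `T`. -/
theorem det_Smat_submatrix_eq_sum_trekSystems
    {V : Type u} [Fintype V] [DecidableEq V]
    (DO : Finset (V × V)) (hDO : ∀ p ∈ DO, p.1 ≠ p.2)
    (hacyc : ∀ v : V, ¬ Relation.TransGen (fun v w => (v, w) ∈ DO) v v)
    (Kf : V × V → Finset ℕ)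
    (hKedge : ∀ p ∈ DO, (Kf p).Nonempty)
    (hKself : ∀ v : V, 0 ∉ Kf (v, v))
    (σ : GField V ≃+* GField V)
    (hσz : σ (gv (GVar.z : GVar V)) = (gv (GVar.z : GVar V))⁻¹)
    (hσφ : ∀ (v w : V) (k : ℕ), σ (gv (GVar.phi v w k)) = gv (GVar.phi v w k))
    (hσω : ∀ v : V, σ (gv (GVar.omega v)) = gv (GVar.omega v))
    (hσR : ∀ a : ℝ, σ (gconst a) = (gconst a : GField V))
    (r : ℕ) (x y : Fin r → V) (hx : Function.Injective x) (hy : Function.Injective y) :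
    ((Smat DO Kf σ).submatrix x y).det =
      ∑ᶠ T : TrekSystem (fun v w => (v, w) ∈ DO) r x y,
        ((Equiv.Perm.sign T.perm : ℤ) : GField V) *
          ∏ i, (T.trek i).weight (Hmat DO Kf) (SImat Kf σ) σ := by

  obtain ⟨rk, hrk⟩ := exists_rank hacyc
  haveI := DiPath.finite hrk
  letI := Fintype.ofFinite (DiPath (fun v w => (v, w) ∈ DO))
  haveI : CharZero (GField V) := charZero_of_injective_algebraMap
    (IsFractionRing.injective (MvPolynomial (GVar V) ℝ) (GField V))
  have hH : ∀ v w, ¬ ((v, w) ∈ DO) → Hmat DO Kf v w = 0 := by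
    intro v w h; simp [Hmat, h]
  have hH' : ∀ v w, ¬ ((v, w) ∈ DO) → ((Hmat DO Kf).map σ) v w = 0 := by
    intro v w h; simp [hH v w h]
  have hS : Smat DO Kf σ = ((1 - Hmat DO Kf)⁻¹)ᵀ *
      Matrix.diagonal (fun v => SImat Kf σ v v) * (1 - (Hmat DO Kf).map σ)⁻¹ := by
    simp only [Smat, Matrix.transpose_nonsing_inv, SImat, Matrix.diagonal_apply_eq]
  rw [hS, det_core _ _ _ _ _ hH (inv_eq _ hH hrk) hH' (inv_eq _ hH' hrk) hrk x y hx hy]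
  exact (finsum_trek (Hmat DO Kf) (SImat Kf σ) (σ : GField V →+* GField V) x y).symm
end

section
/- Let G = (V, D) be a finite acyclic directed graph with no self-loops, with a nonempty finite lag set K_{v,w} ⊆ ℕ for each edge (v,w) ∈ D and a finite self-lag set K_{v,v} ⊆ ℕ∖{0} for each v ∈ V. Choose real coefficients φ_{v,w,k} ∈ ℝ for all these lags with Σ_{j ∈ K_{v,v}} |φ_{v,v,j}| < 1 for every v ∈ V, and real numbers ω_v > 0. Form the matrices over the field ℝ(z): H with H_{v,w} = (Σ_{k ∈ K_{v,w}} φ_{v,w,k} z^k)/(1 − Σ_{j ∈ K_{w,w}} φ_{w,w,j} z^j) for (v,w) ∈ D and 0 otherwise, the diagonal matrix S^I with S^I_{v,v} = ω_v/((1 − φ_{v,v}(z))·(1 − φ_{v,v}(z))*), and S := ((I − H)ᵀ)⁻¹ · S^I · (I − H*)⁻¹, where ()* is the conjugation on ℝ(z) applied entrywise. If a pair (Z_X, Z_Y) of subsets of V t-separates X from Y, then the rank of [S]_{X,Y} as a matrix over the field ℝ(z) is at most |Z_X| + |Z_Y|. -/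
open Matrix Polynomial
open scoped Classical BigOperators

/-- The image of a real polynomial in the field `ℝ(z)` of rational functions. -/
noncomputable def pr (f : Polynomial ℝ) : RatFunc ℝ :=
  algebraMap (Polynomial ℝ) (RatFunc ℝ) f

/-- The conjugation on `ℝ(z)`: for nonzero `r = f/g` it is `(f*/g*)·z^(deg g − deg f)`,
defined via the canonical representation `r = r.num / r.denom`; `0* := 0`. -/
noncomputable def ratConj (r : RatFunc ℝ) : RatFunc ℝ :=
  if r = 0 then 0
  else (pr r.num.reverse / pr r.denom.reverse) *
    RatFunc.X ^ ((r.denom.natDegree : ℤ) - (r.num.natDegree : ℤ))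

/-- The pair `(ZX, ZY)` t-separates `X` from `Y`: every trek from a vertex of `X` to a
vertex of `Y` has the vertex set of its Left path meeting `ZX` or the vertex set of its
Right path meeting `ZY`. -/
def TSep {V : Type*} (E : V → V → Prop) (X Y ZX ZY : Finset V) : Prop :=
  ∀ τ : Trek E, τ.left.last ∈ X → τ.right.last ∈ Y →
    (∃ u ∈ τ.left.verts, u ∈ ZX) ∨ (∃ u ∈ τ.right.verts, u ∈ ZY)

/-- The lag polynomial `φ_{v,w}(z) = Σ_{k ∈ K(v,w)} φ_{v,w,k}·z^k` with real coefficients. -/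
noncomputable def lagPolyR {V : Type*} (Kf : V × V → Finset ℕ) (φ : V → V → ℕ → ℝ)
    (v w : V) : Polynomial ℝ :=
  ∑ k ∈ Kf (v, w), Polynomial.C (φ v w k) * Polynomial.X ^ k

/-- The direct transfer matrix over `ℝ(z)` with real coefficients:
`H_{v,w} = φ_{v,w}(z)/(1 − φ_{w,w}(z))` on edges and `0` elsewhere. -/
noncomputable def HmatR {V : Type*} [DecidableEq V] (DO : Finset (V × V))
    (Kf : V × V → Finset ℕ) (φ : V → V → ℕ → ℝ) : Matrix V V (RatFunc ℝ) :=
  fun v w => if (v, w) ∈ DO then pr (lagPolyR Kf φ v w) / pr (1 - lagPolyR Kf φ w w) else 0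

/-- The internal spectrum over `ℝ(z)`: the diagonal matrix with entries
`ω_v/((1 − φ_{v,v}(z))·(1 − φ_{v,v}(z))*)`. -/
noncomputable def SImatR {V : Type*} [DecidableEq V] (Kf : V × V → Finset ℕ)
    (φ : V → V → ℕ → ℝ) (ω : V → ℝ) : Matrix V V (RatFunc ℝ) :=
  Matrix.diagonal fun v =>
    RatFunc.C (ω v) /
      (pr (1 - lagPolyR Kf φ v v) * ratConj (pr (1 - lagPolyR Kf φ v v)))

/-- The spectrum `S = ((I − H)ᵀ)⁻¹ · S^I · (I − H*)⁻¹` over `ℝ(z)`, where `H*` applies the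
conjugation `()*` entrywise to `H`. -/
noncomputable def SmatR {V : Type*} [Fintype V] [DecidableEq V] (DO : Finset (V × V))
    (Kf : V × V → Finset ℕ) (φ : V → V → ℕ → ℝ) (ω : V → ℝ) : Matrix V V (RatFunc ℝ) :=
  ((1 - HmatR DO Kf φ)ᵀ)⁻¹ * SImatR Kf φ ω * (1 - (HmatR DO Kf φ).map ratConj)⁻¹

section TsepHelpers

lemma tsep_wf {V : Type*} [Finite V] (E : V → V → Prop)
    (hacyc : ∀ v : V, ¬ Relation.TransGen E v v) : WellFounded (fun a b => E b a) := by
  have : IsTrans V (fun a b => Relation.TransGen E b a) := ⟨fun a b c h1 h2 => h2.trans h1⟩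
  have : Std.Irrefl (fun a b => Relation.TransGen E b a) := ⟨fun a => hacyc a⟩
  have h := Finite.wellFounded_of_trans_of_irrefl (fun a b => Relation.TransGen E b a)
  exact Subrelation.wf (fun {a b} hab => Relation.TransGen.single hab) h

lemma tsep_isUnit {V F : Type*} [Fintype V] [DecidableEq V] [Field F] (E : V → V → Prop)
    (hwf : WellFounded (fun a b => E b a)) (H : Matrix V V F)
    (hH : ∀ u w, H u w ≠ 0 → E u w) : IsUnit (1 - H).det := by
  rw [isUnit_iff_ne_zero]
  intro hdet
  obtain ⟨v, hv, hv0⟩ := Matrix.exists_mulVec_eq_zero_iff.mpr hdet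
  apply hv
  funext u
  induction u using hwf.induction with
  | _ u ih =>
    have h := congrFun hv0 u
    rw [Matrix.sub_mulVec, Matrix.one_mulVec, Pi.sub_apply, Pi.zero_apply, sub_eq_zero] at h
    rw [h]
    simp only [Matrix.mulVec, dotProduct, Pi.zero_apply]
    refine Finset.sum_eq_zero fun w _ => ?_
    by_cases h0 : H u w = 0
    · rw [h0, zero_mul]
    · rw [ih w (hH u w h0), Pi.zero_apply, mul_zero]

lemma tsep_path {V F : Type*} [Fintype V] [DecidableEq V] [Field F] (E : V → V → Prop)
    (hwf : WellFounded (fun a b => E b a)) (Z : Finset V) (K M : Matrix V V F)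
    (hK : ∀ u w, K u w ≠ 0 → E u w ∧ u ∉ Z) (hM : M = 1 + K * M) (x : V) (hx : x ∉ Z) (u : V)
    (hu : M u x ≠ 0) :
    ∃ p : DiPath E, p.first = u ∧ p.last = x ∧ ∀ v ∈ p.verts, v ∉ Z := by
  induction u using hwf.induction with
  | _ u ih =>
    by_cases hux : u = x
    · subst hux
      exact ⟨⟨[u], by simp, List.isChain_singleton u⟩, rfl, rfl, by simpa using hx⟩
    · rw [hM, Matrix.add_apply, Matrix.one_apply_ne hux, zero_add, Matrix.mul_apply] at hu
      obtain ⟨w, -, hw⟩ := Finset.exists_ne_zero_of_sum_ne_zero hu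
      obtain ⟨hE, huZ⟩ := hK u w (left_ne_zero_of_mul hw)
      obtain ⟨⟨l, hl, hc⟩, h1, h2, h3⟩ := ih w hE (right_ne_zero_of_mul hw)
      cases l with
      | nil => exact absurd rfl hl
      | cons a l =>
        simp only [DiPath.first, List.head_cons] at h1
        subst h1
        refine ⟨⟨u :: a :: l, by simp, List.IsChain.cons_cons hE hc⟩, rfl, ?_, ?_⟩
        · simpa [DiPath.last] using h2
        · intro v hv
          rcases List.mem_cons.mp hv with rfl | hv
          · exact huZ
          · exact h3 v hv

lemma tsep_decomp {V F : Type*} [Fintype V] [DecidableEq V] [Field F] (E : V → V → Prop)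
    (hwf : WellFounded (fun a b => E b a)) (H : Matrix V V F)
    (hH : ∀ u w, H u w ≠ 0 → E u w) (Z : Finset V) :
    ∃ N T P : Matrix V V F, (1 - H)⁻¹ = N + T * P * (1 - H)⁻¹ ∧ P.rank ≤ Z.card ∧
      ∀ u x, N u x ≠ 0 → ∃ p : DiPath E, p.first = u ∧ p.last = x ∧ ∀ v ∈ p.verts, v ∉ Z := by
  set P : Matrix V V F := Matrix.diagonal fun v => if v ∈ Z then 1 else 0 with hP
  set Q : Matrix V V F := Matrix.diagonal fun v => if v ∈ Z then 0 else 1 with hQ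
  have hPQ : P + Q = 1 := by
    rw [hP, hQ, Matrix.diagonal_add, ← Matrix.diagonal_one]
    congr 1; funext v; split_ifs <;> simp
  have hQQ : Q * Q = Q := by
    rw [hQ, Matrix.diagonal_mul_diagonal]
    congr 1; funext v; split_ifs <;> simp
  set K := Q * H * Q with hKdef
  have hK : ∀ u w, K u w ≠ 0 → E u w ∧ u ∉ Z := by
    intro u w h
    rw [hKdef, hQ, Matrix.mul_diagonal, Matrix.diagonal_mul] at h
    have h1 := left_ne_zero_of_mul h
    refine ⟨hH u w (right_ne_zero_of_mul h1), fun hu => left_ne_zero_of_mul h1 (if_pos hu)⟩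
  have uK := tsep_isUnit E hwf K fun u w h => (hK u w h).1
  have uH := tsep_isUnit E hwf H hH
  set A := (1 - H)⁻¹ with hA
  set M := (1 - K)⁻¹ with hM
  have eA : (1 - H) * A = 1 := Matrix.mul_nonsing_inv _ uH
  have eM : (1 - K) * M = 1 := Matrix.mul_nonsing_inv _ uK
  have eM' : M * (1 - K) = 1 := Matrix.nonsing_inv_mul _ uK
  refine ⟨M * Q, M * Q * H + 1, P, ?_, ?_, ?_⟩
  · have hPe : P = 1 - Q := eq_sub_of_add_eq hPQ
    have key : (1 - K) * (Q * A) = Q + Q * H * P * A := by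
      have h2 : Q * ((1 - H) * A) = Q := by rw [eA, mul_one]
      have h3 : Q * H * Q * (Q * A) = Q * H * Q * A := by
        rw [← mul_assoc, mul_assoc (Q * H) Q Q, hQQ]
      rw [hPe, hKdef, sub_mul, h3, one_mul]
      calc Q * A - Q * H * Q * A = Q * ((1 - H) * A) + Q * H * (1 - Q) * A := by noncomm_ring
        _ = _ := by rw [h2]
    have h4 : Q * A = M * (Q + Q * H * P * A) := by
      rw [← key, ← mul_assoc, eM', one_mul]
    calc A = Q * A + P * A := by rw [← add_mul, add_comm, hPQ, one_mul]
      _ = M * (Q + Q * H * P * A) + P * A := by rw [← h4]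
      _ = _ := by noncomm_ring
  · rw [hP, Matrix.rank_diagonal, Fintype.card_subtype]
    refine Finset.card_le_card fun v hv => ?_
    by_contra h
    simp [h] at hv
  · intro u x h
    rw [hQ, Matrix.mul_diagonal] at h
    have hx : x ∉ Z := fun hx => right_ne_zero_of_mul h (if_pos hx)
    refine tsep_path E hwf Z K M hK ?_ x hx u (left_ne_zero_of_mul h)
    rw [sub_mul, one_mul] at eM
    exact eq_add_of_sub_eq eM

lemma tsep_rank_add {V F : Type*} [Fintype V] [DecidableEq V] [Field F] (A B : Matrix V V F) :
    (A + B).rank ≤ A.rank + B.rank := by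
  unfold Matrix.rank
  rw [Matrix.mulVecLin_add]
  refine le_trans (Submodule.finrank_mono (t := LinearMap.range A.mulVecLin ⊔
    LinearMap.range B.mulVecLin) ?_) (Submodule.finrank_add_le_finrank_add_finrank _ _)
  rintro _ ⟨v, rfl⟩
  exact Submodule.add_mem_sup ⟨v, rfl⟩ ⟨v, rfl⟩

lemma tsep_main {V F : Type*} [Fintype V] [DecidableEq V] [Field F] (E : V → V → Prop)
    (hacyc : ∀ v : V, ¬ Relation.TransGen E v v) (H H' : Matrix V V F)
    (hH : ∀ u w, H u w ≠ 0 → E u w) (hH' : ∀ u w, H' u w ≠ 0 → E u w) (d : V → F)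
    (X Y ZX ZY : Finset V) (hsep : TSep E X Y ZX ZY) :
    ((((1 - H)ᵀ)⁻¹ * Matrix.diagonal d * (1 - H')⁻¹).submatrix (fun a : {u // u ∈ X} => (a : V))
        (fun b : {u // u ∈ Y} => (b : V))).rank ≤ ZX.card + ZY.card := by
  have hwf := tsep_wf E hacyc
  obtain ⟨N, T, P, e, hr, hN⟩ := tsep_decomp E hwf H hH ZX
  obtain ⟨N', T', P', e', hr', hN'⟩ := tsep_decomp E hwf H' hH' ZY
  rw [← Matrix.transpose_nonsing_inv]
  set A := (1 - H)⁻¹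
  set B := (1 - H')⁻¹
  set D := Matrix.diagonal d with hD
  have hz : ∀ x ∈ X, ∀ y ∈ Y, (Nᵀ * D * N') x y = 0 := by
    intro x hx y hy
    rw [Matrix.mul_apply]
    refine Finset.sum_eq_zero fun u _ => ?_
    rw [hD, Matrix.mul_diagonal, Matrix.transpose_apply]
    by_contra h
    obtain ⟨p, p1, p2, p3⟩ := hN u x (left_ne_zero_of_mul (left_ne_zero_of_mul h))
    obtain ⟨q, q1, q2, q3⟩ := hN' u y (right_ne_zero_of_mul h)
    rcases hsep ⟨p, q, p1.trans q1.symm⟩ (p2 ▸ hx) (q2 ▸ hy) with ⟨v, hv, hv'⟩ | ⟨v, hv, hv'⟩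
    · exact p3 v hv hv'
    · exact q3 v hv hv'
  have hW : Aᵀ * D * B = Nᵀ * D * N' + (Aᵀ * Pᵀ * (Tᵀ * D * B) + Nᵀ * D * T' * P' * B) := by
    have e1 : Aᵀ = Nᵀ + Aᵀ * Pᵀ * Tᵀ := by
      conv_lhs => rw [e]
      rw [Matrix.transpose_add, Matrix.transpose_mul, Matrix.transpose_mul, mul_assoc]
    calc Aᵀ * D * B = (Nᵀ + Aᵀ * Pᵀ * Tᵀ) * D * B := by rw [← e1]
      _ = Nᵀ * D * B + Aᵀ * Pᵀ * (Tᵀ * D * B) := by noncomm_ring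
      _ = Nᵀ * D * (N' + T' * P' * B) + Aᵀ * Pᵀ * (Tᵀ * D * B) := by rw [← e']
      _ = _ := by noncomm_ring
  have hsub : (Aᵀ * D * B).submatrix (fun a : {u // u ∈ X} => (a : V))
        (fun b : {u // u ∈ Y} => (b : V)) =
      (Aᵀ * Pᵀ * (Tᵀ * D * B) + Nᵀ * D * T' * P' * B).submatrix (fun a : {u // u ∈ X} => (a : V))
        (fun b : {u // u ∈ Y} => (b : V)) := by
    ext a b
    rw [hW, Matrix.submatrix_apply, Matrix.submatrix_apply, Matrix.add_apply,
      hz a a.2 b b.2, zero_add]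
  rw [hsub]
  refine (Matrix.rank_submatrix_le _ _ _).trans ((tsep_rank_add _ _).trans ?_)
  refine add_le_add ?_ ?_
  · refine (Matrix.rank_mul_le_left _ _).trans ((Matrix.rank_mul_le_right _ _).trans ?_)
    rwa [Matrix.rank_transpose]
  · exact (Matrix.rank_mul_le_left _ _).trans ((Matrix.rank_mul_le_right _ _).trans hr')

end TsepHelpers

/-- for a finite acyclic process graph with stable real SVAR coefficients and
positive noise variances, if a pair `(Z_X, Z_Y)` of subsets of `V` t-separates `X` from `Y`,
then the rank of `[S]_{X,Y}` as a matrix over the field `ℝ(z)` is at most `|Z_X| + |Z_Y|`. -/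
theorem rank_SmatR_le_of_tsep
    {V : Type*} [Fintype V] [DecidableEq V]
    (DO : Finset (V × V)) (hDO : ∀ p ∈ DO, p.1 ≠ p.2)
    (hacyc : ∀ v : V, ¬ Relation.TransGen (fun v w => (v, w) ∈ DO) v v)
    (Kf : V × V → Finset ℕ)
    (hKedge : ∀ p ∈ DO, (Kf p).Nonempty)
    (hKself : ∀ v : V, 0 ∉ Kf (v, v))
    (φ : V → V → ℕ → ℝ) (hstab : ∀ v : V, ∑ j ∈ Kf (v, v), |φ v v j| < 1)
    (ω : V → ℝ) (hω : ∀ v, 0 < ω v)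
    (X Y ZX ZY : Finset V)
    (hsep : TSep (fun v w => (v, w) ∈ DO) X Y ZX ZY) :
    ((SmatR DO Kf φ ω).submatrix (fun a : {u // u ∈ X} => (a : V))
        (fun b : {u // u ∈ Y} => (b : V))).rank ≤ ZX.card + ZY.card := by
  have h1 : ∀ u w, HmatR DO Kf φ u w ≠ 0 → (u, w) ∈ DO := by
    intro u w h
    by_contra hn
    exact h (if_neg hn)
  refine tsep_main (fun v w => (v, w) ∈ DO) hacyc _ _ h1 ?_ _ X Y ZX ZY hsep
  intro u w h
  refine h1 u w fun h0 => h ?_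
  rw [Matrix.map_apply, h0]
  exact if_pos rfl
end
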